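/- Let U be a domain in ℝ² whose Euclidean boundary ∂U is contained in some straight line. Then U fails to be uniquely determined in the class of all domains in ℝ² by the relative metric of its Hausdorff boundary if and only if ∂U is a connected set containing more than one point. -/

import Mathlib

open Set Metric Filter

noncomputable section

/-- Euclidean `n`-space. -/
abbrev Euc (n : ℕ) := EuclideanSpace ℝ (Fin n)

/-- A domain: a nonempty open connected subset of Euclidean space. -/
def IsEucDomain {n : ℕ} (U : Set (Euc n)) : Prop := IsOpen U ∧ IsConnected U

/-- Intrinsic extended distance inside `S`: the infimum of the lengths (total
variations) of continuous paths joining `x` and `y` within `S`. -/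
def intrinsicDist {n : ℕ} (S : Set (Euc n)) (x y : Euc n) : ENNReal :=
  ⨅ (γ : ℝ → Euc n) (_ : ContinuousOn γ (Icc (0:ℝ) 1)) (_ : γ 0 = x) (_ : γ 1 = y)
    (_ : MapsTo γ (Icc (0:ℝ) 1) S), eVariationOn γ (Icc (0:ℝ) 1)

/-- A Cauchy sequence (in the intrinsic metric) of points of `U` that does not
converge (in the intrinsic metric) to a point of `U`; such sequences represent
elements of the Hausdorff boundary of `U`. -/
structure HBSeq {n : ℕ} (U : Set (Euc n)) where
  seq : ℕ → Euc n
  mem : ∀ k, seq k ∈ U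
  cauchy : ∀ ε : ENNReal, 0 < ε → ∃ N : ℕ, ∀ j ≥ N, ∀ k ≥ N,
    intrinsicDist U (seq j) (seq k) < ε
  notConv : ¬ ∃ u ∈ U, Tendsto (fun k => intrinsicDist U (seq k) u) atTop (nhds 0)

/-- Two Cauchy sequences represent the same Hausdorff-boundary element iff the
intrinsic distance between corresponding terms tends to `0`. -/
def HBEquiv {n : ℕ} (U : Set (Euc n)) (s t : HBSeq U) : Prop :=
  Tendsto (fun k => intrinsicDist U (s.seq k) (t.seq k)) atTop (nhds 0)

/-- The Hausdorff boundary of `U`: points of the completion of `(U, ρ_U)` not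
corresponding to points of `U`. -/
def HausdorffBoundary {n : ℕ} (U : Set (Euc n)) : Type := Quot (HBEquiv U)

/-- The relative metric on the Hausdorff boundary (the completion metric). -/
def hbDist {n : ℕ} {U : Set (Euc n)} (a b : HausdorffBoundary U) : ENNReal :=
  limsup (fun k => intrinsicDist U ((Quot.out a).seq k) ((Quot.out b).seq k)) atTop

/-- The support of a Hausdorff-boundary element: the Euclidean limit of a
representing Cauchy sequence. -/
def hbSupport {n : ℕ} {U : Set (Euc n)} (a : HausdorffBoundary U) : Euc n :=
  limUnder atTop (Quot.out a).seq

/-- A (bijective) isometry of Hausdorff boundaries in the relative metrics. -/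
def IsHBIsometry {n : ℕ} {U V : Set (Euc n)}
    (f : HausdorffBoundary U → HausdorffBoundary V) : Prop :=
  Function.Bijective f ∧ ∀ a b : HausdorffBoundary U, hbDist (f a) (f b) = hbDist a b

/-- `U` is uniquely determined in the class `𝒰` by the relative metric of its
Hausdorff boundary: any member of `𝒰` with Hausdorff boundary isometric (in the
relative metrics) to that of `U` is the image of `U` under a Euclidean isometry. -/
def UniquelyDeterminedIn {n : ℕ} (𝒰 : Set (Set (Euc n))) (U : Set (Euc n)) : Prop :=
  ∀ V ∈ 𝒰, (∃ f : HausdorffBoundary U → HausdorffBoundary V, IsHBIsometry f) →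
    ∃ J : Euc n ≃ᵢ Euc n, J '' U = V

section IntrinsicDist

variable {n : ℕ} {S : Set (Euc n)} {x y z : Euc n}

theorem intrinsicDist_le_of_path {γ : ℝ → Euc n} {a b : ℝ} (hab : a ≤ b)
    (hγ : ContinuousOn γ (Icc a b)) (hS : MapsTo γ (Icc a b) S) :
    intrinsicDist S (γ a) (γ b) ≤ eVariationOn γ (Icc a b) := by
  have hmaps : MapsTo (fun t : ℝ => a + t * (b - a)) (Icc 0 1) (Icc a b) := by
    rintro t ⟨h0, h1⟩
    constructor <;> nlinarith
  have hmono : MonotoneOn (fun t : ℝ => a + t * (b - a)) (Icc 0 1) := by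
    intro s _ t _ hst
    have : s * (b - a) ≤ t * (b - a) := mul_le_mul_of_nonneg_right hst (by linarith)
    simpa using this
  have hvar := eVariationOn.comp_le_of_monotoneOn γ (s := Icc a b) _ hmono hmaps
  refine le_trans ?_ hvar
  refine iInf_le_of_le (γ ∘ fun t : ℝ => a + t * (b - a)) ?_
  refine iInf_le_of_le (hγ.comp (by fun_prop) hmaps) ?_
  refine iInf_le_of_le (by simp) ?_
  refine iInf_le_of_le (by simp) ?_
  exact iInf_le_of_le (hS.comp hmaps) le_rfl

theorem edist_le_intrinsicDist : edist x y ≤ intrinsicDist S x y := by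
  refine le_iInf fun γ => le_iInf fun _ => le_iInf fun h0 => le_iInf fun h1 => le_iInf fun _ => ?_
  rw [← h0, ← h1]
  exact eVariationOn.edist_le γ (by simp) (by simp)

theorem exists_path_of_intrinsicDist_lt {r : ENNReal} (h : intrinsicDist S x y < r) :
    ∃ γ : ℝ → Euc n, ContinuousOn γ (Icc 0 1) ∧ γ 0 = x ∧ γ 1 = y ∧ MapsTo γ (Icc 0 1) S ∧
      eVariationOn γ (Icc 0 1) < r := by
  simp only [intrinsicDist, iInf_lt_iff] at h
  obtain ⟨γ, hc, h0, h1, hS, hr⟩ := h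
  exact ⟨γ, hc, h0, h1, hS, hr⟩

theorem intrinsicDist_swap_le : intrinsicDist S y x ≤ intrinsicDist S x y := by
  refine le_of_forall_gt fun r hr => ?_
  obtain ⟨γ, hc, rfl, rfl, hS, hr⟩ := exists_path_of_intrinsicDist_lt hr
  refine lt_of_le_of_lt ?_ hr
  have hmaps : MapsTo (fun t : ℝ => 1 - t) (Icc 0 1) (Icc 0 1) := by
    rintro t ⟨h0, h1⟩
    constructor <;> linarith
  have hanti : AntitoneOn (fun t : ℝ => 1 - t) (Icc 0 1) := by
    intro s _ t _ hst
    exact sub_le_sub_left hst 1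
  have hvar := eVariationOn.comp_le_of_antitoneOn γ (s := Icc 0 1) _ hanti hmaps
  have h := intrinsicDist_le_of_path (S := S) (γ := γ ∘ fun t : ℝ => 1 - t) zero_le_one
    (hc.comp (by fun_prop) hmaps) (hS.comp hmaps)
  simp only [Function.comp_apply, sub_zero, sub_self] at h
  exact h.trans hvar

theorem intrinsicDist_comm : intrinsicDist S x y = intrinsicDist S y x :=
  le_antisymm intrinsicDist_swap_le intrinsicDist_swap_le

theorem intrinsicDist_triangle :
    intrinsicDist S x z ≤ intrinsicDist S x y + intrinsicDist S y z := by
  by_cases hx : intrinsicDist S x y = ⊤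
  · simp [hx]
  by_cases hz : intrinsicDist S y z = ⊤
  · simp [hz]
  refine ENNReal.le_of_forall_pos_le_add fun ε hε _ => ?_
  have hε' : ((ε / 2 : NNReal) : ENNReal) ≠ 0 := by
    simpa using hε.ne'
  obtain ⟨γ, hc, hγ0, hγ1, hS, hr⟩ := exists_path_of_intrinsicDist_lt (ENNReal.lt_add_right hx hε')
  obtain ⟨δ, hc', hδ0, hδ1, hS', hr'⟩ :=
    exists_path_of_intrinsicDist_lt (ENNReal.lt_add_right hz hε')
  set η : ℝ → Euc n := fun t => if t ≤ 1 then γ t else δ (t - 1) with hη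
  have e1 : EqOn η γ (Icc 0 1) := fun t ht => if_pos ht.2
  have e2 : EqOn η (δ ∘ fun t => t - 1) (Icc 1 2) := by
    intro t ht
    rcases ht.1.eq_or_lt with h | h
    · subst h
      simp [hη, hγ1, hδ0]
    · simp [hη, not_le.2 h]
  have hmaps : MapsTo (fun t : ℝ => t - 1) (Icc 1 2) (Icc 0 1) := by
    rintro t ⟨h0, h1⟩
    constructor <;> linarith
  have hmono : MonotoneOn (fun t : ℝ => t - 1) (Icc 1 2) := by
    intro s _ t _ hst
    simpa using hst
  have c1 : ContinuousOn η (Icc 0 1) := hc.congr e1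
  have c2 : ContinuousOn η (Icc 1 2) := (hc'.comp (by fun_prop) hmaps).congr e2
  have hu : Icc (0 : ℝ) 2 = Icc 0 1 ∪ Icc 1 2 :=
    (Icc_union_Icc_eq_Icc (by norm_num) (by norm_num)).symm
  have c : ContinuousOn η (Icc 0 2) := by
    rw [hu]
    exact c1.union_of_isClosed c2 isClosed_Icc isClosed_Icc
  have m : MapsTo η (Icc 0 2) S := by
    rw [hu]
    exact (hS.congr e1.symm).union_union (hS'.comp hmaps |>.congr e2.symm) |>.mono_right (by simp)
  have h := intrinsicDist_le_of_path (by norm_num) c m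
  have hv : eVariationOn η (Icc 0 2) = eVariationOn η (Icc 0 1) + eVariationOn η (Icc 1 2) := by
    simpa using (eVariationOn.Icc_add_Icc η (s := univ) (a := (0 : ℝ)) (b := 1) (c := 2)
      (by norm_num) (by norm_num) (mem_univ _)).symm
  have hη0 : η 0 = x := by simp [hη, hγ0]
  have hη2 : η 2 = z := by
    have : (2 : ℝ) - 1 = 1 := by norm_num
    simp [hη, this, hδ1]
  rw [hη0, hη2, hv, eVariationOn.congr e1, eVariationOn.congr e2] at h
  have h3 := eVariationOn.comp_le_of_monotoneOn δ (s := Icc 0 1) _ hmono hmaps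
  calc intrinsicDist S x z ≤ _ := h
    _ ≤ (intrinsicDist S x y + (ε / 2 : NNReal)) + (intrinsicDist S y z + (ε / 2 : NNReal)) :=
        add_le_add hr.le (h3.trans hr'.le)
    _ = intrinsicDist S x y + intrinsicDist S y z + ((ε / 2 : NNReal) + (ε / 2 : NNReal)) := by
        ring
    _ = intrinsicDist S x y + intrinsicDist S y z + ε := by
        rw [← ENNReal.coe_add, add_halves]

theorem intrinsicDist_le_of_lipschitz {γ : ℝ → Euc n} {K : NNReal}
    (hγ : LipschitzOnWith K γ (Icc 0 1)) (hS : MapsTo γ (Icc 0 1) S) :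
    intrinsicDist S (γ 0) (γ 1) ≤ K := by
  refine (intrinsicDist_le_of_path zero_le_one hγ.continuousOn hS).trans ?_
  have h := hγ.comp_eVariationOn_le (g := id) (s := Icc (0 : ℝ) 1) (fun t ht => ht)
  rw [eVariationOn_id_Icc] at h
  simpa using h

theorem intrinsicDist_le_of_segment (h : segment ℝ x y ⊆ S) : intrinsicDist S x y ≤ edist x y := by
  have hlip : LipschitzWith (nndist x y) (AffineMap.lineMap x y : ℝ → Euc n) :=
    lipschitzWith_lineMap x y
  have := intrinsicDist_le_of_lipschitz (S := S) (hlip.lipschitzOnWith (s := Icc 0 1)) (by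
    intro t ht
    apply h
    rw [segment_eq_image_lineMap]
    exact mem_image_of_mem _ ht)
  rwa [AffineMap.lineMap_apply_zero, AffineMap.lineMap_apply_one, ← edist_nndist] at this

theorem intrinsicDist_eq_edist_of_segment (h : segment ℝ x y ⊆ S) :
    intrinsicDist S x y = edist x y :=
  le_antisymm (intrinsicDist_le_of_segment h) edist_le_intrinsicDist

theorem intrinsicDist_self (h : x ∈ S) : intrinsicDist S x x = 0 := by
  rw [intrinsicDist_eq_edist_of_segment (by simpa using h), edist_self]

theorem exists_ball_intrinsicDist_le (hS : IsOpen S) (hx : x ∈ S) :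
    ∃ δ > 0, ball x δ ⊆ S ∧ ∀ y ∈ ball x δ, ∀ z ∈ ball x δ,
      intrinsicDist S y z ≤ edist y z := by
  obtain ⟨δ, hδ, hb⟩ := Metric.isOpen_iff.1 hS x hx
  exact ⟨δ, hδ, hb, fun y hy z hz =>
    intrinsicDist_le_of_segment (((convex_ball x δ).segment_subset hy hz).trans hb)⟩

theorem tendsto_intrinsicDist_of_tendsto (hS : IsOpen S) (hx : x ∈ S) {s : ℕ → Euc n}
    (hs : Tendsto s atTop (nhds x)) :
    Tendsto (fun k => intrinsicDist S (s k) x) atTop (nhds 0) := by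
  obtain ⟨δ, hδ, -, hb⟩ := exists_ball_intrinsicDist_le hS hx
  refine tendsto_of_tendsto_of_tendsto_of_le_of_le' tendsto_const_nhds
    (tendsto_iff_edist_tendsto_0.1 hs) (by simp) ?_
  filter_upwards [hs (ball_mem_nhds x hδ)] with k hk
  exact hb _ hk _ (mem_ball_self hδ)

theorem continuousOn_intrinsicDist (hS : IsOpen S) : ContinuousOn (intrinsicDist S x) S := by
  intro y hy
  obtain ⟨δ, hδ, -, hb⟩ := exists_ball_intrinsicDist_le hS hy
  have hc : ContinuousOn (intrinsicDist S x) (ball y δ) := by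
    rw [continuousOn_iff_continuous_domRestrict]
    refine continuous_of_le_add_edist 1 (by simp) fun u v => ?_
    simp only [Set.domRestrict_apply, one_mul]
    refine (intrinsicDist_triangle (y := v.1)).trans ?_
    gcongr
    rw [edist_comm]
    exact hb _ v.2 _ u.2
  exact (hc.continuousAt (ball_mem_nhds y hδ)).continuousWithinAt

theorem exists_intrinsicDist_lt_of_dense (hS : IsOpen S) {D : Set (Euc n)} (hD : Dense D)
    (hx : x ∈ S) {ε : ℝ} (hε : 0 < ε) :
    ∃ y ∈ S ∩ D, intrinsicDist S x y < ENNReal.ofReal ε ∧ dist x y < ε := by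
  obtain ⟨δ, hδ, hbS, hb⟩ := exists_ball_intrinsicDist_le hS hx
  obtain ⟨y, hyD, hy⟩ := hD.exists_dist_lt x (lt_min hδ hε)
  rw [dist_comm] at hy
  have hyb : y ∈ ball x δ := hy.trans_le (min_le_left _ _)
  have hye : dist x y < ε := by
    rw [dist_comm]; exact hy.trans_le (min_le_right _ _)
  refine ⟨y, ⟨hbS hyb, hyD⟩, (hb x (mem_ball_self hδ) y hyb).trans_lt ?_, hye⟩
  rwa [edist_dist, ENNReal.ofReal_lt_ofReal_iff hε]

theorem edist_le_intrinsicDist_of_local {X : Type*} [PseudoEMetricSpace X] (h : Euc n → X)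
    (hloc : ∀ u ∈ S, ∃ δ > 0, ∀ v ∈ ball u δ, ∀ w ∈ ball u δ, v ∈ S → w ∈ S →
      edist (h v) (h w) ≤ edist v w) :
    edist (h x) (h y) ≤ intrinsicDist S x y := by
  refine le_iInf fun γ => le_iInf fun hc => le_iInf fun h0 => le_iInf fun h1 => le_iInf fun hm => ?_
  subst h0 h1
  choose! δ hδ hh using hloc
  have hcr : Continuous ((Icc (0 : ℝ) 1).domRestrict γ) :=
    continuousOn_iff_continuous_domRestrict.1 hc
  obtain ⟨t, ht0, htm, ⟨m, htm1⟩, htc⟩ := exists_monotone_Icc_subset_open_cover_Icc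
    (zero_le_one (α := ℝ)) (c := fun u : S => (Icc (0 : ℝ) 1).domRestrict γ ⁻¹' ball u (δ u))
    (fun u => isOpen_ball.preimage hcr) (fun r _ => mem_iUnion.2
      ⟨⟨γ r, hm r.2⟩, mem_ball_self (hδ _ (hm r.2))⟩)
  have step : ∀ k, edist (h (γ (t k))) (h (γ (t (k + 1)))) ≤ edist (γ (t k)) (γ (t (k + 1))) := by
    intro k
    obtain ⟨u, hu⟩ := htc k
    have a := hu (left_mem_Icc.2 (htm (Nat.le_succ k)))
    have b := hu (right_mem_Icc.2 (htm (Nat.le_succ k)))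
    exact hh u u.2 _ a _ b (hm (t k).2) (hm (t (k + 1)).2)
  calc edist (h (γ 0)) (h (γ 1)) = edist (h (γ (t 0))) (h (γ (t m))) := by
        rw [ht0, htm1 m le_rfl]
    _ ≤ ∑ k ∈ Finset.range m, edist (h (γ (t k))) (h (γ (t (k + 1)))) :=
        edist_le_range_sum_edist (fun k => h (γ (t k))) m
    _ ≤ ∑ k ∈ Finset.range m, edist (γ (t k)) (γ (t (k + 1))) :=
        Finset.sum_le_sum fun k _ => step k
    _ = ∑ k ∈ Finset.range m, edist (γ (t (k + 1))) (γ (t k)) := by simp_rw [edist_comm]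
    _ ≤ eVariationOn γ (Icc 0 1) := eVariationOn.sum_le (u := fun k => (t k : ℝ))
        (fun i j hij => htm hij) (fun k => (t k).2)

end IntrinsicDist

section HausdorffBoundary

variable {n : ℕ} {U : Set (Euc n)}

theorem HBSeq.tendsto_limUnder (s : HBSeq U) :
    Tendsto s.seq atTop (nhds (limUnder atTop s.seq)) := by
  refine CauchySeq.tendsto_limUnder (EMetric.cauchySeq_iff.2 fun ε hε => ?_)
  obtain ⟨N, hN⟩ := s.cauchy ε hε
  exact ⟨N, fun j hj k hk => edist_le_intrinsicDist.trans_lt (hN j hj k hk)⟩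

theorem HBSeq.limUnder_notMem (hU : IsOpen U) (s : HBSeq U) : limUnder atTop s.seq ∉ U :=
  fun h => s.notConv ⟨_, h, tendsto_intrinsicDist_of_tendsto hU h s.tendsto_limUnder⟩

theorem tendsto_hbSupport (a : HausdorffBoundary U) :
    Tendsto (Quot.out a).seq atTop (nhds (hbSupport a)) :=
  (Quot.out a).tendsto_limUnder

theorem hbSupport_notMem (hU : IsOpen U) (a : HausdorffBoundary U) : hbSupport a ∉ U :=
  (Quot.out a).limUnder_notMem hU

theorem hbSupport_mem_closure (a : HausdorffBoundary U) : hbSupport a ∈ closure U :=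
  mem_closure_of_tendsto (tendsto_hbSupport a) (Eventually.of_forall (Quot.out a).mem)

theorem hbEquiv_equivalence : Equivalence (HBEquiv U) where
  refl s := by
    simp only [HBEquiv, intrinsicDist_self (s.mem _)]
    exact tendsto_const_nhds
  symm h := by
    simpa only [HBEquiv, intrinsicDist_comm] using h
  trans {s t u} h h' := by
    refine tendsto_of_tendsto_of_tendsto_of_le_of_le tendsto_const_nhds ?_
      (fun _ => zero_le) (fun k => intrinsicDist_triangle (y := t.seq k))
    simpa using Tendsto.add h h'

theorem hbEquiv_out_mk (s : HBSeq U) :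
    HBEquiv U (Quot.out (Quot.mk (HBEquiv U) s)) s := by
  have h := Quot.out_eq (Quot.mk (HBEquiv U) s)
  rw [Quot.eq, hbEquiv_equivalence.eqvGen_iff] at h
  exact h

theorem hbDist_le_of_tendsto {a b : HausdorffBoundary U} {x y : ℕ → Euc n} {F : ℕ → ENNReal}
    {c : ENNReal}
    (hx : Tendsto (fun k => intrinsicDist U ((Quot.out a).seq k) (x k)) atTop (nhds 0))
    (hy : Tendsto (fun k => intrinsicDist U ((Quot.out b).seq k) (y k)) atTop (nhds 0))
    (hF : ∀ᶠ k in atTop, intrinsicDist U (x k) (y k) ≤ F k) (hc : Tendsto F atTop (nhds c)) :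
    hbDist a b ≤ c := by
  have h : Tendsto (fun k => intrinsicDist U ((Quot.out a).seq k) (x k) + F k +
      intrinsicDist U ((Quot.out b).seq k) (y k)) atTop (nhds c) := by
    simpa using (hx.add hc).add hy
  rw [← h.limsup_eq]
  refine limsup_le_limsup ?_
  filter_upwards [hF] with k hk
  calc intrinsicDist U ((Quot.out a).seq k) ((Quot.out b).seq k)
      ≤ intrinsicDist U ((Quot.out a).seq k) (x k) + intrinsicDist U (x k) (y k) +
          intrinsicDist U (y k) ((Quot.out b).seq k) :=
        intrinsicDist_triangle.trans (add_le_add_left intrinsicDist_triangle _)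
    _ ≤ _ := by
        rw [intrinsicDist_comm (x := y k)]
        gcongr

theorem eq_of_hbDist_eq_zero {a b : HausdorffBoundary U} (h : hbDist a b = 0) : a = b := by
  rw [← Quot.out_eq a, ← Quot.out_eq b]
  exact Quot.sound (tendsto_of_le_liminf_of_limsup_le zero_le h.le)

theorem edist_hbSupport_le_hbDist (a b : HausdorffBoundary U) :
    edist (hbSupport a) (hbSupport b) ≤ hbDist a b := by
  rw [← ((tendsto_hbSupport a).edist (tendsto_hbSupport b)).limsup_eq]
  exact limsup_le_limsup (Eventually.of_forall fun k => edist_le_intrinsicDist)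

/-- The distance in the completion from a point of `U` to a point of the Hausdorff boundary. -/
def hbPointDist (z : Euc n) (a : HausdorffBoundary U) : ENNReal :=
  limsup (fun k => intrinsicDist U z ((Quot.out a).seq k)) atTop

theorem hbDist_le_hbPointDist_add (z : Euc n) (a b : HausdorffBoundary U) :
    hbDist a b ≤ hbPointDist z a + hbPointDist z b := by
  refine ENNReal.le_of_forall_pos_le_add fun ε hε hfin => ?_
  obtain ⟨ha, hb⟩ := ENNReal.add_lt_top.1 hfin
  have hε' : ((ε / 2 : NNReal) : ENNReal) ≠ 0 := by
    simpa using hε.ne'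
  have h1 := eventually_lt_of_limsup_lt (ENNReal.lt_add_right ha.ne hε')
  have h2 := eventually_lt_of_limsup_lt (ENNReal.lt_add_right hb.ne hε')
  refine limsup_le_of_le (by isBoundedDefault) ?_
  filter_upwards [h1, h2] with k hk1 hk2
  calc intrinsicDist U ((Quot.out a).seq k) ((Quot.out b).seq k)
      ≤ intrinsicDist U z ((Quot.out a).seq k) + intrinsicDist U z ((Quot.out b).seq k) := by
        rw [intrinsicDist_comm (x := z) (y := (Quot.out a).seq k)]
        exact intrinsicDist_triangle
    _ ≤ (hbPointDist z a + (ε / 2 : NNReal)) + (hbPointDist z b + (ε / 2 : NNReal)) :=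
        add_le_add hk1.le hk2.le
    _ = hbPointDist z a + hbPointDist z b + ((ε / 2 : NNReal) + (ε / 2 : NNReal)) := by ring
    _ = hbPointDist z a + hbPointDist z b + ε := by rw [← ENNReal.coe_add, add_halves]

theorem edist_le_hbPointDist (z : Euc n) (a : HausdorffBoundary U) :
    edist z (hbSupport a) ≤ hbPointDist z a := by
  rw [← ((tendsto_const_nhds (x := z)).edist (tendsto_hbSupport a)).limsup_eq]
  exact limsup_le_limsup (Eventually.of_forall fun k => edist_le_intrinsicDist)

/-- A sequence of points of `U` that is Cauchy for the intrinsic metric and converges to a point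
outside `U`. -/
def HBSeq.ofTendsto (s : ℕ → Euc n) (hs : ∀ k, s k ∈ U) {e : Euc n} (he : e ∉ U)
    (hlim : Tendsto s atTop (nhds e)) {G : ℕ → ENNReal} (hG : Tendsto G atTop (nhds 0))
    (hsG : ∀ j k, intrinsicDist U (s j) (s k) ≤ G j + G k) : HBSeq U where
  seq := s
  mem := hs
  cauchy ε hε := by
    have h := hG.eventually (gt_mem_nhds (ENNReal.half_pos hε.ne'))
    obtain ⟨N, hN⟩ := eventually_atTop.1 h
    refine ⟨N, fun j hj k hk => (hsG j k).trans_lt ?_⟩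
    rw [← ENNReal.add_halves ε]
    exact ENNReal.add_lt_add (hN j hj) (hN k hk)
  notConv := by
    rintro ⟨u, hu, h⟩
    have : Tendsto s atTop (nhds u) := tendsto_iff_edist_tendsto_0.2
      (tendsto_of_tendsto_of_tendsto_of_le_of_le tendsto_const_nhds h (fun _ => zero_le)
        fun k => edist_le_intrinsicDist)
    exact he (tendsto_nhds_unique hlim this ▸ hu)

theorem hbSupport_mk (s : HBSeq U) {e : Euc n} (h : Tendsto s.seq atTop (nhds e)) :
    hbSupport (Quot.mk (HBEquiv U) s) = e := by
  refine tendsto_nhds_unique (tendsto_hbSupport _) ?_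
  refine (tendsto_iff_of_dist ?_).2 h
  have h0 : Tendsto (fun k => edist ((Quot.out (Quot.mk (HBEquiv U) s)).seq k) (s.seq k)) atTop
      (nhds 0) :=
    tendsto_of_tendsto_of_tendsto_of_le_of_le tendsto_const_nhds (hbEquiv_out_mk s)
      (fun _ => zero_le) fun k => edist_le_intrinsicDist
  have h1 := (ENNReal.tendsto_toReal ENNReal.zero_ne_top).comp h0
  simpa [Function.comp_def, edist_dist, ENNReal.toReal_ofReal] using h1

theorem exists_visible_hbSupport (hU : IsOpen U) {z q : Euc n} (hz : z ∈ U) (hq : q ∉ U) :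
    ∃ a : HausdorffBoundary U, hbSupport a ∈ segment ℝ z q ∧
      hbPointDist z a ≤ edist z (hbSupport a) := by
  have hcl : IsCompact (Icc (0 : ℝ) 1 ∩ (AffineMap.lineMap z q : ℝ → Euc n) ⁻¹' Uᶜ) :=
    isCompact_Icc.inter_right (hU.isClosed_compl.preimage AffineMap.lineMap_continuous)
  obtain ⟨t, ⟨⟨ht0, ht1⟩, htU⟩, hmin⟩ := hcl.exists_isLeast ⟨1, by simp, by simpa using hq⟩
  set e : Euc n := AffineMap.lineMap z q t with he
  have hin : ∀ r ∈ Ico (0 : ℝ) 1, (AffineMap.lineMap z e r : Euc n) ∈ U := by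
    rintro r ⟨hr0, hr1⟩
    by_contra hr
    have hlm : (AffineMap.lineMap z e r : Euc n) = AffineMap.lineMap z q (r * t) := by
      simp [he, AffineMap.lineMap_apply, smul_smul]
    rw [hlm] at hr
    have h1 := hmin ⟨⟨by positivity, by nlinarith⟩, hr⟩
    have htpos : 0 < t := by
      rcases ht0.eq_or_lt with h | h
      · subst h
        simp [hz] at htU
      · exact h
    nlinarith
  have hseg : ∀ r ∈ Ico (0 : ℝ) 1, ∀ r' ∈ Ico (0 : ℝ) 1,
      intrinsicDist U (AffineMap.lineMap z e r) (AffineMap.lineMap z e r') ≤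
        edist (AffineMap.lineMap z e r : Euc n) (AffineMap.lineMap z e r') := by
    intro r hr r' hr'
    refine intrinsicDist_le_of_segment ?_
    rw [← image_segment]
    rintro _ ⟨u, hu, rfl⟩
    exact hin u ((convex_Ico 0 1).segment_subset hr hr' hu)
  set ρ : ℕ → ℝ := fun k => 1 - 1 / ((k : ℝ) + 1) with hρ
  have hρm : ∀ k, ρ k ∈ Ico (0 : ℝ) 1 := by
    intro k
    have h1 : 0 < 1 / ((k : ℝ) + 1) := by positivity
    have h2 : 1 / ((k : ℝ) + 1) ≤ 1 := by
      rw [div_le_one (by positivity)]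
      have : (0 : ℝ) ≤ k := by positivity
      linarith
    constructor <;> simp only [hρ] <;> linarith
  have hρlim : Tendsto ρ atTop (nhds 1) := by
    simpa only [sub_zero] using
      (tendsto_const_nhds (x := (1 : ℝ))).sub (tendsto_one_div_add_atTop_nhds_zero_nat (𝕜 := ℝ))
  have hlim : Tendsto (fun k => (AffineMap.lineMap z e (ρ k) : Euc n)) atTop (nhds e) := by
    have := (AffineMap.lineMap_continuous (p := z) (q := e) (R := ℝ)).tendsto 1 |>.comp hρlim
    rwa [AffineMap.lineMap_apply_one] at this
  let s : HBSeq U := HBSeq.ofTendsto (fun k => AffineMap.lineMap z e (ρ k))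
    (fun k => hin _ (hρm k)) htU hlim (tendsto_iff_edist_tendsto_0.1 hlim) (fun j k =>
      (hseg _ (hρm j) _ (hρm k)).trans (edist_triangle_right _ _ _))
  have hs : hbSupport (Quot.mk (HBEquiv U) s) = e := hbSupport_mk s hlim
  refine ⟨Quot.mk _ s, ?_, ?_⟩
  · rw [hs, he, segment_eq_image_lineMap]
    exact mem_image_of_mem _ ⟨ht0, ht1⟩
  · rw [hs]
    have h1 : Tendsto (fun k => edist z (s.seq k) +
        intrinsicDist U (s.seq k) ((Quot.out (Quot.mk (HBEquiv U) s)).seq k)) atTop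
          (nhds (edist z e + 0)) := by
      refine Tendsto.add (tendsto_const_nhds.edist hlim) ?_
      exact hbEquiv_equivalence.symm (hbEquiv_out_mk s)
    rw [← add_zero (edist z e), ← h1.limsup_eq]
    refine limsup_le_limsup (Eventually.of_forall fun k => ?_)
    refine intrinsicDist_triangle.trans (add_le_add_left ?_ _)
    have h2 := hseg 0 (by simp) (ρ k) (hρm k)
    rwa [AffineMap.lineMap_apply_zero] at h2

theorem exists_hbSupport_eq (hU : IsOpen U) {z q : Euc n} (hz : z ∈ U) (hq : q ∉ U)
    (hseg : ∀ x ∈ segment ℝ z q, x ≠ q → x ∈ U) : ∃ a : HausdorffBoundary U, hbSupport a = q := by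
  obtain ⟨a, ha, -⟩ := exists_visible_hbSupport hU hz hq
  refine ⟨a, ?_⟩
  by_contra hne
  exact hbSupport_notMem hU a (hseg _ ha hne)

theorem exists_hausdorffBoundary_equiv (hU : IsOpen U) {X : Type*} [MetricSpace X]
    [CompleteSpace X] (h : Euc n → X) (E : Euc n → ℝ) (hE : Continuous E)
    (hE0 : ∀ q ∈ closure U, q ∉ U → E q = 0)
    (hlow : ∀ z ∈ U, ∀ w ∈ U, edist (h z) (h w) ≤ intrinsicDist U z w)
    (hupp : ∀ z ∈ U, ∀ w ∈ U,
      intrinsicDist U z w ≤ edist (h z) (h w) + (ENNReal.ofReal (E z) + ENNReal.ofReal (E w)))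
    (hsurj : ∀ x, ∃ s : ℕ → Euc n, (∀ k, s k ∈ U) ∧ Tendsto (h ∘ s) atTop (nhds x) ∧
      ∃ q ∉ U, Tendsto s atTop (nhds q)) :
    ∃ φ : HausdorffBoundary U ≃ X, ∀ a b, edist (φ a) (φ b) = hbDist a b := by
  have hEs : ∀ (s : ℕ → Euc n) (q : Euc n), (∀ k, s k ∈ U) → q ∉ U → Tendsto s atTop (nhds q) →
      Tendsto (fun k => ENNReal.ofReal (E (s k))) atTop (nhds 0) := by
    intro s q hs hq hlim
    have h1 := (hE.tendsto q).comp hlim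
    rw [hE0 q (mem_closure_of_tendsto hlim (Eventually.of_forall hs)) hq] at h1
    simpa [Function.comp_def] using (ENNReal.continuous_ofReal.tendsto 0).comp h1
  have hlim : ∀ a : HausdorffBoundary U, ∃ x, Tendsto (h ∘ (Quot.out a).seq) atTop (nhds x) := by
    intro a
    refine cauchySeq_tendsto_of_complete (EMetric.cauchySeq_iff.2 fun ε hε => ?_)
    obtain ⟨N, hN⟩ := (Quot.out a).cauchy ε hε
    exact ⟨N, fun j hj k hk => (hlow _ ((Quot.out a).mem j) _ ((Quot.out a).mem k)).trans_lt
      (hN j hj k hk)⟩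
  choose φ hφ using hlim
  have hdist : ∀ a b, edist (φ a) (φ b) = hbDist a b := by
    intro a b
    have h1 := (hφ a).edist (hφ b)
    have h2 := h1.add ((hEs _ _ (Quot.out a).mem (hbSupport_notMem hU a) (tendsto_hbSupport a)).add
      (hEs _ _ (Quot.out b).mem (hbSupport_notMem hU b) (tendsto_hbSupport b)))
    rw [add_zero, add_zero] at h2
    exact (tendsto_of_tendsto_of_tendsto_of_le_of_le h1 h2
      (fun k => hlow _ ((Quot.out a).mem k) _ ((Quot.out b).mem k))
      (fun k => hupp _ ((Quot.out a).mem k) _ ((Quot.out b).mem k))).limsup_eq.symm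
  refine ⟨Equiv.ofBijective φ ⟨fun a b hab => eq_of_hbDist_eq_zero ?_, fun x => ?_⟩, hdist⟩
  · rw [← hdist, hab, edist_self]
  · obtain ⟨s, hs, hx, q, hq, hsq⟩ := hsurj x
    have hG : Tendsto (fun k => edist (h (s k)) x + ENNReal.ofReal (E (s k))) atTop (nhds 0) := by
      simpa using (tendsto_iff_edist_tendsto_0.1 hx).add (hEs s q hs hq hsq)
    let t : HBSeq U := HBSeq.ofTendsto s hs hq hsq hG (fun j k => by
      refine (hupp _ (hs j) _ (hs k)).trans ((add_le_add_left
        (edist_triangle_right _ _ x) _).trans_eq ?_)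
      ring)
    refine ⟨Quot.mk _ t, tendsto_nhds_unique (hφ _) ?_⟩
    refine tendsto_iff_edist_tendsto_0.2 (tendsto_of_tendsto_of_tendsto_of_le_of_le
      tendsto_const_nhds ?_ (fun _ => zero_le) fun k => edist_triangle _ (h (s k)) _)
    rw [← add_zero (0 : ENNReal)]
    refine Tendsto.add (tendsto_of_tendsto_of_tendsto_of_le_of_le tendsto_const_nhds
      (hbEquiv_out_mk t) (fun _ => zero_le) fun k => ?_) (tendsto_iff_edist_tendsto_0.1 hx)
    exact hlow _ ((Quot.out (Quot.mk _ t)).mem k) _ (hs k)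

theorem exists_isHBIsometry_of_equiv {V : Set (Euc n)} {X : Type*} [MetricSpace X]
    (hU : ∃ φ : HausdorffBoundary U ≃ X, ∀ a b, edist (φ a) (φ b) = hbDist a b)
    (hV : ∃ φ : HausdorffBoundary V ≃ X, ∀ a b, edist (φ a) (φ b) = hbDist a b) :
    ∃ f : HausdorffBoundary U → HausdorffBoundary V, IsHBIsometry f := by
  obtain ⟨φ, hφ⟩ := hU
  obtain ⟨ψ, hψ⟩ := hV
  refine ⟨φ.trans ψ.symm, Equiv.bijective _, fun a b => ?_⟩
  rw [← hψ, ← hφ]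
  simp

end HausdorffBoundary

section Rigidity

/-- The line through `a` in direction `v`. -/
def lineThrough (a v : Euc 2) : Set (Euc 2) := range fun t : ℝ => a + t • v

open MeasureTheory in
theorem volume_lineThrough (a v : Euc 2) : volume (lineThrough a v) = 0 := by
  have hne : AffineSubspace.mk' a (Submodule.span ℝ {v}) ≠ ⊤ := by
    intro h
    have h1 := congrArg AffineSubspace.direction h
    rw [AffineSubspace.direction_mk', AffineSubspace.direction_top] at h1
    have h2 := finrank_span_le_card (R := ℝ) ({v} : Set (Euc 2))
    rw [h1, finrank_top, finrank_euclideanSpace] at h2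
    simp at h2
  refine measure_mono_null ?_ (Measure.addHaar_affineSubspace volume _ hne)
  rintro _ ⟨t, rfl⟩
  simp [AffineSubspace.mem_mk', Submodule.mem_span_singleton]

open MeasureTheory in
theorem dense_compl_lineThrough_union (a v b w : Euc 2) :
    Dense (lineThrough a v ∪ lineThrough b w)ᶜ := by
  have h : volume (lineThrough a v ∪ lineThrough b w) = 0 :=
    measure_union_null (volume_lineThrough a v) (volume_lineThrough b w)
  exact Measure.dense_of_ae (μ := volume) (measure_eq_zero_iff_ae_notMem.1 h)

theorem dense_compl_lineThrough (a v : Euc 2) : Dense (lineThrough a v)ᶜ := by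
  simpa using dense_compl_lineThrough_union a v a v

theorem exists_seq_of_dense {n : ℕ} {V : Set (Euc n)} (hV : IsOpen V) {D : Set (Euc n)}
    (hD : Dense D) (a : HausdorffBoundary V) :
    ∃ x : ℕ → Euc n, (∀ k, x k ∈ V ∩ D) ∧
      Tendsto (fun k => intrinsicDist V ((Quot.out a).seq k) (x k)) atTop (nhds 0) ∧
      Tendsto x atTop (nhds (hbSupport a)) := by
  have h : ∀ k : ℕ, ∃ y ∈ V ∩ D,
      intrinsicDist V ((Quot.out a).seq k) y < ENNReal.ofReal (1 / ((k : ℝ) + 1)) ∧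
      dist ((Quot.out a).seq k) y < 1 / ((k : ℝ) + 1) := fun k =>
    exists_intrinsicDist_lt_of_dense hV hD ((Quot.out a).mem k) (by positivity)
  choose x hx h1 h2 using h
  have h0 := tendsto_one_div_add_atTop_nhds_zero_nat (𝕜 := ℝ)
  refine ⟨x, hx, ?_, ?_⟩
  · have h3 := (ENNReal.continuous_ofReal.tendsto 0).comp h0
    rw [ENNReal.ofReal_zero] at h3
    exact tendsto_of_tendsto_of_tendsto_of_le_of_le tendsto_const_nhds h3 (fun _ => zero_le)
      fun k => (h1 k).le
  · refine (tendsto_iff_of_dist ?_).1 (tendsto_hbSupport a)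
    exact squeeze_zero (fun _ => dist_nonneg) (fun k => (h2 k).le) h0

theorem segment_subset_of_compl_subset_line {V : Set (Euc 2)} {a v : Euc 2}
    (hline : Vᶜ ⊆ lineThrough a v) {g q : Euc 2} (hg : g ∈ V) (hgl : g ∈ lineThrough a v)
    (hq : q ∉ lineThrough a v) : segment ℝ g q ⊆ V := by
  rw [segment_eq_image_lineMap]
  rintro _ ⟨r, hr, rfl⟩
  by_contra hx
  obtain ⟨t, ht⟩ := hline hx
  obtain ⟨s, rfl⟩ := hgl
  have hr0 : r ≠ 0 := by
    rintro rfl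
    exact hx (by simpa using hg)
  refine hq ⟨s + (t - s) / r, ?_⟩
  simp only [AffineMap.lineMap_apply_module] at ht ⊢
  have h : r • q = a + t • v - (1 - r) • (a + s • v) := by
    rw [ht]; abel
  have h2 : q = r⁻¹ • (a + t • v - (1 - r) • (a + s • v)) := by
    rw [← h, smul_smul, inv_mul_cancel₀ hr0, one_smul]
  rw [h2]
  match_scalars <;> field_simp <;> ring

theorem intrinsicDist_le_of_compl_subset_line {V : Set (Euc 2)} (hV : IsOpen V) {a v : Euc 2}
    (hline : Vᶜ ⊆ lineThrough a v) {g q : Euc 2} (hg : g ∈ V) (hgl : g ∈ lineThrough a v)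
    (hq : q ∈ V) : intrinsicDist V g q ≤ edist g q := by
  refine ENNReal.le_of_forall_pos_le_add fun ε hε _ => ?_
  obtain ⟨y, ⟨-, hy⟩, h1, h2⟩ := exists_intrinsicDist_lt_of_dense hV (dense_compl_lineThrough a v)
    hq (ε := ε / 2) (by positivity)
  calc intrinsicDist V g q ≤ intrinsicDist V g y + intrinsicDist V y q := intrinsicDist_triangle
    _ ≤ edist g y + intrinsicDist V q y := by
        rw [intrinsicDist_comm (x := y)]
        gcongr
        exact intrinsicDist_le_of_segment (segment_subset_of_compl_subset_line hline hg hgl hy)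
    _ ≤ (edist g q + edist q y) + ENNReal.ofReal (ε / 2) := by
        gcongr
        exact edist_triangle _ _ _
    _ ≤ (edist g q + ENNReal.ofReal (ε / 2)) + ENNReal.ofReal (ε / 2) := by
        gcongr
        rw [edist_dist]
        exact ENNReal.ofReal_le_ofReal h2.le
    _ = edist g q + ε := by
        rw [add_assoc, ← ENNReal.ofReal_add (by positivity) (by positivity), add_halves,
          ENNReal.ofReal_coe_nnreal]

theorem hbDist_eq_edist_of_compl_subset_line {V : Set (Euc 2)} (hV : IsOpen V) {a v : Euc 2}
    (hline : Vᶜ ⊆ lineThrough a v) (hacc : ∀ δ > 0, ∃ g ∈ V ∩ lineThrough a v, edist a g < δ)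
    {α : HausdorffBoundary V} (hα : hbSupport α = a) (ε : HausdorffBoundary V) :
    hbDist α ε = edist a (hbSupport ε) := by
  refine le_antisymm ?_ (hα ▸ edist_hbSupport_le_hbDist α ε)
  refine ENNReal.le_of_forall_pos_le_add fun η hη _ => ?_
  obtain ⟨g, ⟨hg, hgl⟩, hag⟩ := hacc (η / 2 : NNReal) (by simpa using hη.ne')
  obtain ⟨x, hx, hx0, hxl⟩ := exists_seq_of_dense hV (dense_compl_lineThrough a v) α
  obtain ⟨y, hy, hy0, hyl⟩ := exists_seq_of_dense hV (dense_compl_lineThrough a v) ε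
  have h := hbDist_le_of_tendsto hx0 hy0 (F := fun k => edist g (x k) + edist g (y k))
    (Eventually.of_forall fun k => ?_)
    ((tendsto_const_nhds.edist hxl).add (tendsto_const_nhds.edist hyl))
  · rw [hα] at h
    calc hbDist α ε ≤ edist g a + edist g (hbSupport ε) := h
      _ ≤ edist g a + (edist g a + edist a (hbSupport ε)) := by
          gcongr
          exact edist_triangle _ _ _
      _ ≤ (η / 2 : NNReal) + ((η / 2 : NNReal) + edist a (hbSupport ε)) := by
          rw [edist_comm g a]
          gcongr
      _ = edist a (hbSupport ε) + ((η / 2 : NNReal) + (η / 2 : NNReal)) := by ring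
      _ = edist a (hbSupport ε) + η := by rw [← ENNReal.coe_add, add_halves]
  · refine intrinsicDist_triangle.trans (add_le_add ?_
      (intrinsicDist_le_of_compl_subset_line hV hline hg hgl (hy k).1))
    rw [intrinsicDist_comm]
    exact intrinsicDist_le_of_compl_subset_line hV hline hg hgl (hx k).1

theorem exists_near_midpoint {n : ℕ} {V : Set (Euc n)} (hV : IsOpen V) {α β : HausdorffBoundary V}
    {d η : ℝ} (hd : 0 < d) (hη : 0 < η) (h : hbDist α β = ENNReal.ofReal d) :
    ∃ z ∈ V, hbPointDist z α ≤ ENNReal.ofReal (d / 2 + η) ∧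
      hbPointDist z β ≤ ENNReal.ofReal (d / 2 + η) := by
  have hη2 : 0 < ENNReal.ofReal (η / 2) := ENNReal.ofReal_pos.2 (by positivity)
  obtain ⟨N, hN⟩ := (Quot.out α).cauchy _ hη2
  obtain ⟨M, hM⟩ := (Quot.out β).cauchy _ hη2
  have hlt : ENNReal.ofReal (d / 2) < hbDist α β := by
    rw [h]
    exact (ENNReal.ofReal_lt_ofReal_iff hd).2 (by linarith)
  have hgt : hbDist α β < ENNReal.ofReal (d + η / 2) := by
    rw [h]
    exact (ENNReal.ofReal_lt_ofReal_iff (by positivity)).2 (by linarith)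
  obtain ⟨k, hk1, hk2, hkN, hkM⟩ :=
    ((frequently_lt_of_lt_limsup (by isBoundedDefault) hlt).and_eventually
    ((eventually_lt_of_limsup_lt hgt).and ((eventually_ge_atTop N).and
      (eventually_ge_atTop M)))).exists
  obtain ⟨γ, hc, h0, h1, hS, hvar⟩ := exists_path_of_intrinsicDist_lt hk2
  have hcont : ContinuousOn (fun t => intrinsicDist V ((Quot.out α).seq k) (γ t)) (Icc 0 1) :=
    (continuousOn_intrinsicDist hV).comp hc hS
  obtain ⟨τ, hτ, hτd⟩ := intermediate_value_Icc zero_le_one hcont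
    (show ENNReal.ofReal (d / 2) ∈ _ by
      constructor
      · simp only [h0, intrinsicDist_self ((Quot.out α).mem k), zero_le]
      · simpa only [h1] using hk1.le)
  simp only at hτd
  have e1 := intrinsicDist_le_of_path (S := V) hτ.1 (hc.mono (Icc_subset_Icc_right hτ.2))
    (hS.mono_left (Icc_subset_Icc_right hτ.2))
  have e2 := intrinsicDist_le_of_path (S := V) hτ.2 (hc.mono (Icc_subset_Icc_left hτ.1))
    (hS.mono_left (Icc_subset_Icc_left hτ.1))
  have hv : eVariationOn γ (Icc 0 τ) + eVariationOn γ (Icc τ 1) = eVariationOn γ (Icc 0 1) := by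
    simpa using eVariationOn.Icc_add_Icc γ (s := univ) hτ.1 hτ.2 (mem_univ _)
  rw [h0, hτd] at e1
  rw [h1] at e2
  have e3 : intrinsicDist V (γ τ) ((Quot.out β).seq k) ≤ ENNReal.ofReal (d / 2 + η / 2) := by
    have : ENNReal.ofReal (d / 2) + intrinsicDist V (γ τ) ((Quot.out β).seq k) ≤
        ENNReal.ofReal (d / 2) + ENNReal.ofReal (d / 2 + η / 2) := by
      rw [← ENNReal.ofReal_add (by positivity) (by positivity)]
      refine ((add_le_add e1 e2).trans_eq hv).trans (hvar.le.trans_eq ?_)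
      congr 1
      ring
    exact (ENNReal.add_le_add_iff_left ENNReal.ofReal_ne_top).1 this
  have hsum : ENNReal.ofReal (d / 2 + η / 2) + ENNReal.ofReal (η / 2) =
      ENNReal.ofReal (d / 2 + η) := by
    rw [← ENNReal.ofReal_add (by positivity) (by positivity)]
    congr 1
    ring
  refine ⟨γ τ, hS hτ, ?_, ?_⟩
  · refine limsup_le_of_le (by isBoundedDefault) ?_
    filter_upwards [eventually_ge_atTop N] with j hj
    refine intrinsicDist_triangle.trans (hsum ▸ add_le_add ?_ (hN k hkN j hj).le)
    rw [intrinsicDist_comm, hτd]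
    exact ENNReal.ofReal_le_ofReal (by linarith)
  · refine limsup_le_of_le (by isBoundedDefault) ?_
    filter_upwards [eventually_ge_atTop M] with j hj
    exact intrinsicDist_triangle.trans (hsum ▸ add_le_add e3 (hM k hkM j hj).le)


end Rigidity

section GapRigidity

variable {n : ℕ} {V : Set (Euc n)} {α β : HausdorffBoundary V} {d : ℝ}

theorem exists_near_midpoint_of_gap (hV : IsOpen V) (hd : 0 < d)
    (h : hbDist α β = ENNReal.ofReal d)
    (hgap : ∀ ε, hbDist α ε = ENNReal.ofReal d + hbDist β ε ∨
      hbDist β ε = ENNReal.ofReal d + hbDist α ε) {η : ℝ} (hη : 0 < η) :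
    ∃ z ∈ V, dist z (hbSupport α) ≤ d / 2 + η ∧ dist z (hbSupport β) ≤ d / 2 + η ∧
      ∀ q ∉ V, d / 2 - η + min (dist (hbSupport α) q) (dist (hbSupport β) q) ≤ dist z q := by
  obtain ⟨z, hz, hα, hβ⟩ := exists_near_midpoint hV hd hη h
  have key : ∀ a b : HausdorffBoundary V, hbPointDist z a ≤ ENNReal.ofReal (d / 2 + η) →
      ∀ (q : Euc n) (ε : HausdorffBoundary V), hbSupport ε ∈ segment ℝ z q →
      hbPointDist z ε ≤ edist z (hbSupport ε) → hbDist a ε = ENNReal.ofReal d + hbDist b ε →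
      d / 2 - η + dist (hbSupport b) q ≤ dist z q := by
    intro a b ha q ε hs he hab
    have h1 : ENNReal.ofReal d + edist (hbSupport b) (hbSupport ε) ≤
        ENNReal.ofReal (d / 2 + η) + edist z (hbSupport ε) :=
      calc _ ≤ ENNReal.ofReal d + hbDist b ε := by
            gcongr
            exact edist_hbSupport_le_hbDist b ε
        _ ≤ hbPointDist z a + hbPointDist z ε := hab ▸ hbDist_le_hbPointDist_add z a ε
        _ ≤ _ := add_le_add ha he
    rw [edist_dist, edist_dist, ← ENNReal.ofReal_add hd.le dist_nonneg,
      ← ENNReal.ofReal_add (by positivity) dist_nonneg,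
      ENNReal.ofReal_le_ofReal_iff (by positivity)] at h1
    have h2 := dist_add_dist_of_mem_segment hs
    have h3 := dist_triangle (hbSupport b) (hbSupport ε) q
    linarith
  refine ⟨z, hz, ?_, ?_, fun q hq => ?_⟩
  · rw [← ENNReal.ofReal_le_ofReal_iff (by positivity), ← edist_dist]
    exact (edist_le_hbPointDist z α).trans hα
  · rw [← ENNReal.ofReal_le_ofReal_iff (by positivity), ← edist_dist]
    exact (edist_le_hbPointDist z β).trans hβ
  · obtain ⟨ε, hs, he⟩ := exists_visible_hbSupport hV hz hq
    rcases hgap ε with h | h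
    · have := key α β hα q ε hs he h
      have := min_le_right (dist (hbSupport α) q) (dist (hbSupport β) q)
      linarith
    · have := key β α hβ q ε hs he h
      have := min_le_left (dist (hbSupport α) q) (dist (hbSupport β) q)
      linarith

theorem exists_midpoint_of_gap (hV : IsOpen V) (hd : 0 < d)
    (h : hbDist α β = ENNReal.ofReal d)
    (hgap : ∀ ε, hbDist α ε = ENNReal.ofReal d + hbDist β ε ∨
      hbDist β ε = ENNReal.ofReal d + hbDist α ε) :
    ∃ z, dist z (hbSupport α) ≤ d / 2 ∧ dist z (hbSupport β) ≤ d / 2 ∧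
      ∀ q ∉ V, d / 2 + min (dist (hbSupport α) q) (dist (hbSupport β) q) ≤ dist z q := by
  choose z hz hα hβ hq using fun k : ℕ =>
    exists_near_midpoint_of_gap hV hd h hgap (η := 1 / ((k : ℝ) + 1)) (by positivity)
  have hmem : ∀ k, z k ∈ closedBall (hbSupport α) (d / 2 + 1) := fun k => by
    refine (hα k).trans ?_
    gcongr
    rw [div_le_one (by positivity)]
    linarith [(Nat.cast_nonneg k : (0 : ℝ) ≤ k)]
  obtain ⟨w, -, φ, hφ, hw⟩ := (isCompact_closedBall _ _).tendsto_subseq hmem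
  have h0 := (tendsto_one_div_add_atTop_nhds_zero_nat (𝕜 := ℝ)).comp hφ.tendsto_atTop
  refine ⟨w, ?_, ?_, fun q hqV => ?_⟩
  · have := le_of_tendsto_of_tendsto' (hw.dist tendsto_const_nhds) (h0.const_add (d / 2))
      fun k => hα (φ k)
    simpa using this
  · have := le_of_tendsto_of_tendsto' (hw.dist tendsto_const_nhds) (h0.const_add (d / 2))
      fun k => hβ (φ k)
    simpa using this
  · have := le_of_tendsto_of_tendsto' ((h0.const_sub (d / 2)).add_const
      (min (dist (hbSupport α) q) (dist (hbSupport β) q))) (hw.dist tendsto_const_nhds)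
      fun k => hq (φ k) q hqV
    simpa using this

end GapRigidity

section GapRigidity

theorem mem_lineThrough_of_wbtw {z P x : Euc 2} (h : Wbtw ℝ z P x) (hne : P ≠ z) :
    x ∈ lineThrough z (P - z) := by
  obtain ⟨r, -, rfl⟩ := h
  have hr : r ≠ 0 := by
    rintro rfl
    simp at hne
  refine ⟨r⁻¹, ?_⟩
  simp [AffineMap.lineMap_apply, smul_smul, inv_mul_cancel₀ hr]

theorem mem_lineThrough_of_lineMap {z q w : Euc 2} {r : ℝ} (hr : r ≠ 0)
    (h : AffineMap.lineMap z q r ∈ lineThrough z w) : q ∈ lineThrough z w := by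
  obtain ⟨t, ht⟩ := h
  refine ⟨r⁻¹ * t, ?_⟩
  simp only [AffineMap.lineMap_apply, vsub_eq_sub, vadd_eq_add, add_comm _ z, add_right_inj] at ht
  simp only
  rw [mul_smul, ht, smul_smul, inv_mul_cancel₀ hr, one_smul]
  abel

variable {V : Set (Euc 2)} {d : ℝ} {A B z : Euc 2}

theorem wbtw_of_notMem (hzA : dist z A ≤ d / 2) (hzB : dist z B ≤ d / 2)
    {x : Euc 2} (hx : d / 2 + min (dist A x) (dist B x) ≤ dist z x) :
    Wbtw ℝ z A x ∨ Wbtw ℝ z B x := by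
  rcases min_choice (dist A x) (dist B x) with h | h <;> rw [h] at hx
  · refine Or.inl (dist_add_dist_eq_iff.1 (le_antisymm ?_ (dist_triangle _ _ _)))
    linarith
  · refine Or.inr (dist_add_dist_eq_iff.1 (le_antisymm ?_ (dist_triangle _ _ _)))
    linarith

theorem segment_subset_of_notMem_lineThrough (hd : 0 < d) (hzA : dist z A ≤ d / 2)
    (hzB : dist z B ≤ d / 2)
    (hV : ∀ q ∉ V, d / 2 + min (dist A q) (dist B q) ≤ dist z q) {q : Euc 2}
    (hq : q ∉ lineThrough z (A - z) ∪ lineThrough z (B - z)) : segment ℝ z q ⊆ V := by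
  rw [segment_eq_image_lineMap]
  rintro _ ⟨r, -, rfl⟩
  by_contra hx
  have hb := hV _ hx
  have hr : r ≠ 0 := by
    rintro rfl
    have h0 : 0 ≤ min (dist A z) (dist B z) := le_min dist_nonneg dist_nonneg
    simp only [AffineMap.lineMap_apply_zero, dist_self] at hb
    linarith
  set x := AffineMap.lineMap z q r with hxd
  rcases min_choice (dist A x) (dist B x) with h | h <;> rw [h] at hb
  · refine hq (Or.inl (mem_lineThrough_of_lineMap hr (mem_lineThrough_of_wbtw
      (dist_add_dist_eq_iff.1 (le_antisymm ?_ (dist_triangle _ _ _))) ?_)))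
    · linarith
    · rintro rfl
      linarith
  · refine hq (Or.inr (mem_lineThrough_of_lineMap hr (mem_lineThrough_of_wbtw
      (dist_add_dist_eq_iff.1 (le_antisymm ?_ (dist_triangle _ _ _))) ?_)))
    · linarith
    · rintro rfl
      linarith

theorem le_dist_hbSupport_of_midpoint (hV : IsOpen V) {α β : HausdorffBoundary V} (hd : 0 < d)
    (h : hbDist α β = ENNReal.ofReal d) (hzA : dist z (hbSupport α) ≤ d / 2)
    (hzB : dist z (hbSupport β) ≤ d / 2)
    (hq : ∀ q ∉ V, d / 2 + min (dist (hbSupport α) q) (dist (hbSupport β) q) ≤ dist z q) :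
    d ≤ dist (hbSupport α) (hbSupport β) := by
  have hzV : z ∈ V := by
    by_contra hz
    have hb := hq z hz
    have h0 : 0 ≤ min (dist (hbSupport α) z) (dist (hbSupport β) z) :=
      le_min dist_nonneg dist_nonneg
    rw [dist_self] at hb
    linarith
  obtain ⟨δ, hδ, hball⟩ := Metric.isOpen_iff.1 hV z hzV
  have hdense := dense_compl_lineThrough_union z (hbSupport α - z) z (hbSupport β - z)
  obtain ⟨x, hx, hx0, hxl⟩ := exists_seq_of_dense hV hdense α
  obtain ⟨y, hy, hy0, hyl⟩ := exists_seq_of_dense hV hdense β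
  obtain ⟨τ, hτ0, hτ1, hτδ⟩ : ∃ τ : ℝ, 0 < τ ∧ τ < 1 ∧ τ * (d / 2 + 1) < δ := by
    refine ⟨min (1 / 2) (δ / (2 * (d / 2 + 1))), by positivity, ?_, ?_⟩
    · exact (min_le_left _ _).trans_lt (by norm_num)
    · calc _ ≤ δ / (2 * (d / 2 + 1)) * (d / 2 + 1) := by
            gcongr
            exact min_le_right _ _
        _ = δ / 2 := by field_simp
        _ < δ := by linarith
  have hnear : ∀ {u : ℕ → Euc 2} {P : Euc 2}, Tendsto u atTop (nhds P) → dist z P ≤ d / 2 →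
      ∀ᶠ k in atTop, AffineMap.lineMap z (u k) τ ∈ ball z δ := by
    intro u P hu hP
    have h1 : dist z P < d / 2 + 1 := by linarith
    filter_upwards [((tendsto_const_nhds (x := z)).dist hu).eventually_lt_const h1] with k hk
    rw [mem_ball, dist_lineMap_left, Real.norm_of_nonneg hτ0.le]
    exact (mul_le_mul_of_nonneg_left hk.le hτ0.le).trans_lt hτδ
  have hcont : Continuous fun p : Euc 2 => (AffineMap.lineMap z p τ : Euc 2) := by
    simp only [AffineMap.lineMap_apply_module]
    fun_prop
  have hle := hbDist_le_of_tendsto hx0 hy0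
    (F := fun k => edist (x k) (AffineMap.lineMap z (x k) τ) +
      edist (AffineMap.lineMap z (x k) τ) (AffineMap.lineMap z (y k) τ) +
      edist (AffineMap.lineMap z (y k) τ) (y k)) ?_
    (((hxl.edist ((hcont.tendsto _).comp hxl)).add
      (((hcont.tendsto _).comp hxl).edist ((hcont.tendsto _).comp hyl))).add
      (((hcont.tendsto _).comp hyl).edist hyl))
  · simp only [edist_dist] at hle
    rw [h, ← ENNReal.ofReal_add (by positivity) (by positivity),
      ← ENNReal.ofReal_add (by positivity) (by positivity),
      ENNReal.ofReal_le_ofReal_iff (by positivity), dist_right_lineMap, dist_lineMap_right] at hle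
    have e : dist (AffineMap.lineMap z (hbSupport α) τ : Euc 2)
        (AffineMap.lineMap z (hbSupport β) τ) = τ * dist (hbSupport α) (hbSupport β) := by
      simp only [AffineMap.lineMap_apply_module, dist_add_left, dist_smul₀,
        Real.norm_of_nonneg hτ0.le]
    rw [e, Real.norm_of_nonneg (by linarith)] at hle
    nlinarith
  · filter_upwards [hnear hxl hzA, hnear hyl hzB] with k hkx hky
    have hsx := segment_subset_of_notMem_lineThrough hd hzA hzB hq (hx k).2
    have hsy := segment_subset_of_notMem_lineThrough hd hzA hzB hq (hy k).2
    have hmem : ∀ w : Euc 2, AffineMap.lineMap z w τ ∈ segment ℝ z w := fun w => by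
      rw [segment_eq_image_lineMap]
      exact ⟨τ, ⟨hτ0.le, hτ1.le⟩, rfl⟩
    refine intrinsicDist_triangle.trans (add_le_add (intrinsicDist_triangle.trans
      (add_le_add (intrinsicDist_le_of_segment ?_) (intrinsicDist_le_of_segment ?_)))
      (intrinsicDist_le_of_segment ?_))
    · exact ((convex_segment z _).segment_subset (right_mem_segment ℝ _ _) (hmem _)).trans hsx
    · exact ((convex_ball z δ).segment_subset hkx hky).trans hball
    · exact ((convex_segment z _).segment_subset (hmem _) (right_mem_segment ℝ _ _)).trans hsy

/-- Two boundary elements that are at additive distance `d` as seen from all the others are joined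
by a segment, and the complement of the domain lies on the rest of the line carrying it. -/
theorem exists_line_of_gap (hV : IsOpen V) {α β : HausdorffBoundary V} (hd : 0 < d)
    (h : hbDist α β = ENNReal.ofReal d)
    (hgap : ∀ ε, hbDist α ε = ENNReal.ofReal d + hbDist β ε ∨
      hbDist β ε = ENNReal.ofReal d + hbDist α ε) :
    ∃ v : Euc 2, ‖v‖ = 1 ∧ hbSupport β = hbSupport α + d • v ∧
      ∀ q ∉ V, ∃ t : ℝ, (t ≤ 0 ∨ d ≤ t) ∧ q = hbSupport α + t • v := by
  obtain ⟨z, hzA, hzB, hq⟩ := exists_midpoint_of_gap hV hd h hgap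
  have hAB := le_dist_hbSupport_of_midpoint hV hd h hzA hzB hq
  set A := hbSupport α
  set B := hbSupport β
  have htri := dist_triangle A z B
  rw [dist_comm A z] at htri
  have hAB' : dist A B = d := by linarith
  have hz : z = midpoint ℝ A B := by
    refine eq_midpoint_of_dist_eq_half ?_ ?_ <;> rw [hAB']
    · rw [dist_comm]; linarith
    · linarith
  refine ⟨d⁻¹ • (B - A), ?_, ?_, fun q hqV => ?_⟩
  · rw [norm_smul, ← dist_eq_norm, dist_comm B, hAB', norm_inv, Real.norm_of_nonneg hd.le,
      inv_mul_cancel₀ hd.ne']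
  · rw [smul_smul, mul_inv_cancel₀ hd.ne', one_smul, add_sub_cancel]
  · have hm : z = A + (1 / 2 : ℝ) • (B - A) := by
      rw [hz, midpoint_eq_smul_add, invOf_eq_inv]
      module
    rcases wbtw_of_notMem hzA hzB (hq q hqV) with ⟨r, hr, hP⟩ | ⟨r, hr, hP⟩
    all_goals
      have hr0 : r ≠ 0 := by
        rintro rfl
        rw [AffineMap.lineMap_apply_zero] at hP
        rw [← hP] at hAB'
        first | (rw [dist_comm] at hAB'; linarith) | linarith
      have hqe : q = z + r⁻¹ • (AffineMap.lineMap z q r - z) := by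
        simp [AffineMap.lineMap_apply, smul_smul, inv_mul_cancel₀ hr0]
      have hr1 : 1 ≤ r⁻¹ := (one_le_inv₀ (lt_of_le_of_ne hr.1 hr0.symm)).2 hr.2
      rw [hP, hm] at hqe
    · refine ⟨d / 2 - r⁻¹ * (d / 2), Or.inl (by nlinarith), hqe.trans ?_⟩
      match_scalars <;> field_simp <;> ring
    · refine ⟨d / 2 + r⁻¹ * (d / 2), Or.inr (by nlinarith), hqe.trans ?_⟩
      match_scalars <;> field_simp <;> ring

end GapRigidity

section Transfer

theorem exists_complex_frame {v : Euc 2} (hv : ‖v‖ = 1) : ∃ L : ℂ ≃ₗᵢ[ℝ] Euc 2, L 1 = v := by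
  let L₀ : ℂ ≃ₗᵢ[ℝ] Euc 2 := Complex.orthonormalBasisOneI.repr
  have hc : ‖L₀.symm v‖ = 1 := by rw [L₀.symm.norm_map, hv]
  obtain ⟨θ, hθ⟩ := (Complex.norm_eq_one_iff _).1 hc
  refine ⟨(rotation (Circle.exp θ)).trans L₀, ?_⟩
  rw [LinearIsometryEquiv.trans_apply, rotation_apply, mul_one, Circle.coe_exp, hθ,
    L₀.apply_symm_apply]

theorem exists_isometryEquiv_line (a A : Euc 2) {v w : Euc 2} (hv : ‖v‖ = 1) (hw : ‖w‖ = 1) :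
    ∃ J : Euc 2 ≃ᵢ Euc 2, ∀ t : ℝ, J (a + t • v) = A + t • w := by
  obtain ⟨L, hL⟩ := exists_complex_frame hv
  obtain ⟨M, hM⟩ := exists_complex_frame hw
  refine ⟨((IsometryEquiv.subRight a).trans (L.symm.trans M).toIsometryEquiv).trans
    (IsometryEquiv.addLeft A), fun t => ?_⟩
  have h : L.symm v = 1 := by rw [← hL, L.symm_apply_apply]
  simp only [IsometryEquiv.trans_apply, IsometryEquiv.subRight_apply, add_sub_cancel_left,
    LinearIsometryEquiv.coe_toIsometryEquiv, LinearIsometryEquiv.trans_apply, map_smul, h, hM,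
    IsometryEquiv.addLeft_apply]

theorem exists_hbSupport_eq_of_compl_subset_line {V : Set (Euc 2)} (hV : IsOpen V) {a v : Euc 2}
    (hline : Vᶜ ⊆ lineThrough a v) {q : Euc 2} (hq : q ∉ V) :
    ∃ ε : HausdorffBoundary V, hbSupport ε = q := by
  obtain ⟨z, hz⟩ := (dense_compl_lineThrough a v).nonempty
  refine exists_hbSupport_eq hV (z := z) (by_contra fun h => hz (hline h)) hq fun x hx hxq => ?_
  by_contra hxV
  rw [segment_symm, segment_eq_image_lineMap] at hx
  obtain ⟨r, -, rfl⟩ := hx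
  obtain ⟨s, hs⟩ := hline hq
  obtain ⟨t, ht⟩ := hline hxV
  have hr : r ≠ 0 := by
    rintro rfl
    simp at hxq
  refine hz (?_ : z ∈ lineThrough a v)
  have hqv : lineThrough q v = lineThrough a v := by
    rw [← hs]
    refine Subset.antisymm ?_ ?_
    · rintro _ ⟨u, rfl⟩
      exact ⟨s + u, by module⟩
    · rintro _ ⟨u, rfl⟩
      exact ⟨u - s, by module⟩
  have htl : AffineMap.lineMap q z r ∈ lineThrough q v := hqv ▸ ⟨t, ht⟩
  exact hqv ▸ mem_lineThrough_of_lineMap hr htl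

/-- All points outside `V` lie on the line through `a` in direction `v`, off the open segment
from `a` to `a + d • v`. -/
def HasGap (V : Set (Euc 2)) (a v : Euc 2) (d : ℝ) : Prop :=
  ∀ q ∉ V, ∃ t : ℝ, (t ≤ 0 ∨ d ≤ t) ∧ q = a + t • v

variable {U V : Set (Euc 2)} {a v A w : Euc 2} {d : ℝ}

theorem HasGap.compl_subset (h : HasGap V a v d) : Vᶜ ⊆ lineThrough a v := fun q hq => by
  obtain ⟨t, -, rfl⟩ := h q hq
  exact ⟨t, rfl⟩

theorem HasGap.flip (h : HasGap V a v d) : HasGap V (a + d • v) (-v) d := fun q hq => by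
  obtain ⟨t, ht, rfl⟩ := h q hq
  refine ⟨d - t, ?_, by module⟩
  rcases ht with ht | ht
  · right; linarith
  · left; linarith

theorem HasGap.hbDist_eq (h : HasGap V a v d) (hV : IsOpen V) (hv : ‖v‖ = 1) (hd : 0 < d)
    {α : HausdorffBoundary V} (hα : hbSupport α = a) (ε : HausdorffBoundary V) :
    hbDist α ε = edist a (hbSupport ε) := by
  refine hbDist_eq_edist_of_compl_subset_line hV h.compl_subset (fun δ hδ => ?_) hα ε
  have hv0 : v ≠ 0 := norm_ne_zero_iff.1 (by rw [hv]; exact one_ne_zero)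
  have hlim : Tendsto (fun t : ℝ => edist a (a + t • v)) (nhdsWithin 0 (Ioi 0)) (nhds 0) := by
    have : Continuous fun t : ℝ => edist a (a + t • v) := by fun_prop
    simpa using (this.tendsto 0).mono_left nhdsWithin_le_nhds
  obtain ⟨t, ht, ht0, htd⟩ := ((hlim.eventually_lt_const hδ).and
    (Ioo_mem_nhdsGT hd)).exists
  refine ⟨a + t • v, ⟨?_, t, rfl⟩, ht⟩
  by_contra hq
  obtain ⟨s, hs, he⟩ := h _ hq
  have : t = s := smul_left_injective ℝ hv0 (add_left_cancel he)
  subst this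
  rcases hs with hs | hs <;> linarith

theorem edist_add_smul (a : Euc 2) (hv : ‖v‖ = 1) (s t : ℝ) :
    edist (a + s • v) (a + t • v) = ENNReal.ofReal |s - t| := by
  rw [edist_dist, dist_add_left, dist_eq_norm, ← sub_smul, norm_smul, hv, mul_one,
    Real.norm_eq_abs]

theorem HasGap.eq_image_of_isHBIsometry (h : HasGap U a v d) (hU : IsOpen U) (hV : IsOpen V)
    (hv : ‖v‖ = 1) (hd : 0 < d) (ha : a ∉ U) (hb : a + d • v ∉ U)
    {f : HausdorffBoundary U → HausdorffBoundary V} (hf : IsHBIsometry f) :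
    ∃ J : Euc 2 ≃ᵢ Euc 2, J '' U = V := by
  obtain ⟨α, hα⟩ := exists_hbSupport_eq_of_compl_subset_line hU h.compl_subset ha
  obtain ⟨β, hβ⟩ := exists_hbSupport_eq_of_compl_subset_line hU h.compl_subset hb
  have hv' : ‖-v‖ = 1 := by rw [norm_neg, hv]
  have e0 : ∀ t : ℝ, edist a (a + t • v) = ENNReal.ofReal |t| := fun t => by
    simpa using edist_add_smul a hv 0 t
  have hdα := h.hbDist_eq hU hv hd hα
  have hdβ := h.flip.hbDist_eq hU hv' hd hβ
  have hαβ : hbDist (f α) (f β) = ENNReal.ofReal d := by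
    rw [hf.2, hdα, hβ, e0, abs_of_pos hd]
  have hgap : ∀ ε, hbDist (f α) ε = ENNReal.ofReal d + hbDist (f β) ε ∨
      hbDist (f β) ε = ENNReal.ofReal d + hbDist (f α) ε := by
    intro ε
    obtain ⟨ε, rfl⟩ := hf.1.2 ε
    obtain ⟨t, ht, he⟩ := h _ (hbSupport_notMem hU ε)
    rw [hf.2, hf.2, hdα, hdβ, he, e0, edist_add_smul a hv,
      ← ENNReal.ofReal_add hd.le (abs_nonneg _),
      ← ENNReal.ofReal_add hd.le (abs_nonneg _)]
    rcases ht with ht | ht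
    · right
      rw [abs_of_nonpos ht, abs_of_nonneg (by linarith)]
      rfl
    · left
      rw [abs_of_nonneg (by linarith), abs_of_nonpos (by linarith)]
      congr 1
      ring
  obtain ⟨w, hw, hB, hg⟩ := exists_line_of_gap hV hd hαβ hgap
  set A := hbSupport (f α) with hA
  have hG : HasGap V A w d := hg
  have hw' : ‖-w‖ = 1 := by rw [norm_neg, hw]
  have hcoord : ∀ (ε : HausdorffBoundary U) (s t : ℝ), hbSupport ε = a + s • v →
      hbSupport (f ε) = A + t • w → s = t := by
    intro ε s t hs ht
    have e1 : edist A (hbSupport (f ε)) = edist a (hbSupport ε) := by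
      rw [← hdα, ← hf.2, hG.hbDist_eq hV hw hd rfl]
    have e2 : edist (A + d • w) (hbSupport (f ε)) = edist (a + d • v) (hbSupport ε) := by
      rw [← hdβ, ← hf.2, hG.flip.hbDist_eq hV hw' hd hB]
    rw [hs, ht, e0, ← zero_add (t • w)] at e1
    nth_rw 1 [← add_zero A] at e1
    rw [← zero_smul ℝ w, ← add_smul, edist_add_smul A hw,
      ENNReal.ofReal_eq_ofReal_iff (abs_nonneg _) (abs_nonneg _)] at e1
    rw [hs, ht, edist_add_smul A hw, edist_add_smul a hv,
      ENNReal.ofReal_eq_ofReal_iff (abs_nonneg _) (abs_nonneg _)] at e2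
    rcases abs_eq_abs.1 e1 with e1 | e1 <;> rcases abs_eq_abs.1 e2 with e2 | e2 <;> nlinarith
  obtain ⟨J, hJ⟩ := exists_isometryEquiv_line a A hv hw
  refine ⟨J, ?_⟩
  have hcompl : J '' Uᶜ = Vᶜ := by
    refine Subset.antisymm ?_ fun q hq => ?_
    · rintro _ ⟨q, hq, rfl⟩
      obtain ⟨ε, rfl⟩ := exists_hbSupport_eq_of_compl_subset_line hU h.compl_subset hq
      obtain ⟨s, -, hs⟩ := h _ hq
      obtain ⟨t, -, ht⟩ := hG _ (hbSupport_notMem hV (f ε))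
      rw [hs, hJ, hcoord ε s t hs ht, ← ht]
      exact hbSupport_notMem hV (f ε)
    · obtain ⟨ε, rfl⟩ := exists_hbSupport_eq_of_compl_subset_line hV hG.compl_subset hq
      obtain ⟨ε, rfl⟩ := hf.1.2 ε
      obtain ⟨s, -, hs⟩ := h _ (hbSupport_notMem hU ε)
      obtain ⟨t, -, ht⟩ := hG _ hq
      refine ⟨hbSupport ε, hbSupport_notMem hU ε, ?_⟩
      rw [hs, hJ, hcoord ε s t hs ht, ← ht]
  rw [image_compl_eq J.bijective] at hcompl
  exact compl_injective hcompl

end Transfer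

section Shape

theorem eq_compl_frontier_or_eq_halfPlane {W : Set ℂ} (hW : IsOpen W) (hne : W.Nonempty)
    (hf : frontier W ⊆ {z | z.im = 0}) :
    W = (frontier W)ᶜ ∨ W = {z | 0 < z.im} ∨ W = {z | z.im < 0} := by
  have hdich : ∀ H : Set ℂ, IsPreconnected H → (∀ z ∈ H, z.im ≠ 0) → H ⊆ W ∨ H ⊆ Wᶜ := by
    intro H hH h0
    have h := hH.subset_or_subset hW isClosed_closure.isOpen_compl
      (disjoint_compl_right_iff_subset.2 subset_closure) fun z hz => ?_
    · exact h.imp_right fun h => h.trans (compl_subset_compl.2 subset_closure)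
    · by_contra hzW
      rw [mem_union, not_or, mem_compl_iff, not_not] at hzW
      exact h0 z hz (hf (hW.frontier_eq ▸ hzW.symm))
  have hup := hdich {z | 0 < z.im} (convex_halfSpace_im_gt 0).isPreconnected fun z hz => ne_of_gt hz
  have hlo := hdich {z | z.im < 0} (convex_halfSpace_im_lt 0).isPreconnected fun z hz => ne_of_lt hz
  have hcu : ∀ z : ℂ, z.im = 0 → z ∈ closure {z : ℂ | 0 < z.im} := fun z hz => by
    rw [Complex.closure_setOfPred_lt_im]
    exact hz.ge
  have hcl : ∀ z : ℂ, z.im = 0 → z ∈ closure {z : ℂ | z.im < 0} := fun z hz => by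
    rw [Complex.closure_setOfPred_im_lt]
    exact hz.le
  have hreal : ∀ H : Set ℂ, H ⊆ Wᶜ → ∀ z ∈ closure H, z ∉ W := fun H hH z hz hzW => by
    obtain ⟨w, hw, hwH⟩ := mem_closure_iff.1 hz W hW hzW
    exact hH hwH hw
  rcases hup with hup | hup <;> rcases hlo with hlo | hlo
  · left
    refine Subset.antisymm (fun z hz hzf => (hW.frontier_eq ▸ hzf).2 hz) fun z hz => ?_
    by_contra hzW
    refine hz (hW.frontier_eq ▸ ⟨?_, hzW⟩)
    rcases lt_trichotomy z.im 0 with h | h | h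
    · exact absurd (hlo h) hzW
    · exact closure_mono hup (hcu z h)
    · exact absurd (hup h) hzW
  · right; left
    refine Subset.antisymm (fun z hz => ?_) hup
    rcases lt_trichotomy z.im 0 with h | h | h
    · exact absurd hz (hlo h)
    · exact absurd hz (hreal _ hlo z (hcl z h))
    · exact h
  · right; right
    refine Subset.antisymm (fun z hz => ?_) hlo
    rcases lt_trichotomy z.im 0 with h | h | h
    · exact h
    · exact absurd hz (hreal _ hup z (hcu z h))
    · exact absurd hz (hup h)
  · obtain ⟨z, hz⟩ := hne
    rcases lt_trichotomy z.im 0 with h | h | h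
    · exact absurd hz (hlo h)
    · exact absurd hz (hreal _ hup z (hcu z h))
    · exact absurd hz (hup h)

theorem exists_gap_of_not_ordConnected {T : Set ℝ} (hT : IsClosed T) (h : ¬ T.OrdConnected) :
    ∃ a ∈ T, ∃ b ∈ T, a < b ∧ ∀ t ∈ T, t ≤ a ∨ b ≤ t := by
  rw [ordConnected_iff] at h
  push Not at h
  obtain ⟨x, hx, y, hy, -, h⟩ := h
  obtain ⟨m, hm, hmT⟩ := not_subset.1 h
  obtain ⟨a, ⟨haT, ham⟩, ha⟩ := (isCompact_Icc.inter_left hT).exists_isGreatest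
    (s := T ∩ Icc x m) ⟨x, hx, le_rfl, hm.1⟩
  obtain ⟨b, ⟨hbT, hbm⟩, hb⟩ := (isCompact_Icc.inter_left hT).exists_isLeast
    (s := T ∩ Icc m y) ⟨y, hy, hm.2, le_rfl⟩
  have ham' : a < m := lt_of_le_of_ne ham.2 (by rintro rfl; exact hmT haT)
  refine ⟨a, haT, b, hbT, ham'.trans_le hbm.1, fun t ht => ?_⟩
  by_contra! hab
  rcases le_total t m with htm | htm
  · exact absurd (ha ⟨ht, ham.1.trans hab.1.le, htm⟩) (not_le.2 hab.1)
  · exact absurd (hb ⟨ht, htm, hab.2.le.trans hbm.2⟩) (not_le.2 hab.2)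

/-- The Euclidean coordinates on the plane with origin `p` and orthonormal frame `L`. -/
def planeFrame (p : Euc 2) (L : ℂ ≃ₗᵢ[ℝ] Euc 2) : ℂ ≃ᵢ Euc 2 :=
  L.toIsometryEquiv.trans (IsometryEquiv.addLeft p)

theorem planeFrame_apply (p : Euc 2) (L : ℂ ≃ₗᵢ[ℝ] Euc 2) (z : ℂ) :
    planeFrame p L z = p + L z := rfl

theorem planeFrame_ofReal (p : Euc 2) (L : ℂ ≃ₗᵢ[ℝ] Euc 2) (t : ℝ) :
    planeFrame p L t = p + t • L 1 := by
  rw [planeFrame_apply, ← map_smul]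
  simp

theorem exists_planeFrame_of_frontier_subset_line {U : Set (Euc 2)}
    (hline : ∃ p v : Euc 2, v ≠ 0 ∧ ∀ x ∈ frontier U, ∃ t : ℝ, x = p + t • v) :
    ∃ (p : Euc 2) (L : ℂ ≃ₗᵢ[ℝ] Euc 2) (W : Set ℂ), U = planeFrame p L '' W ∧
      frontier W ⊆ {z | z.im = 0} := by
  obtain ⟨p, v, hv, h⟩ := hline
  obtain ⟨L, hL⟩ := exists_complex_frame (v := ‖v‖⁻¹ • v) (by
    rw [norm_smul, norm_inv, norm_norm, inv_mul_cancel₀ (norm_ne_zero_iff.2 hv)])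
  refine ⟨p, L, planeFrame p L ⁻¹' U, (image_preimage_eq _ (planeFrame p L).surjective).symm, ?_⟩
  have hfr := (planeFrame p L).toHomeomorph.preimage_frontier U
  rw [IsometryEquiv.coe_toHomeomorph] at hfr
  rw [← hfr]
  intro z hz
  obtain ⟨t, ht⟩ := h _ hz
  have : z = ((t * ‖v‖ : ℝ) : ℂ) := by
    refine (planeFrame p L).injective (ht.trans ?_)
    rw [planeFrame_ofReal, hL, smul_smul, mul_assoc, mul_inv_cancel₀ (norm_ne_zero_iff.2 hv),
      mul_one]
  rw [this]
  exact Complex.ofReal_im _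

theorem hasGap_of_not_isPreconnected {W : Set ℂ} (hW : IsOpen W) (hne : W.Nonempty)
    (hf : frontier W ⊆ {z | z.im = 0}) (hnp : ¬ IsPreconnected (frontier W)) (p : Euc 2)
    (L : ℂ ≃ₗᵢ[ℝ] Euc 2) : ∃ a d, 0 < d ∧ a ∉ planeFrame p L '' W ∧
      a + d • L 1 ∉ planeFrame p L '' W ∧ HasGap (planeFrame p L '' W) a (L 1) d := by
  have hcompl : W = (frontier W)ᶜ := by
    refine (eq_compl_frontier_or_eq_halfPlane hW hne hf).resolve_right ?_
    have hre : IsPreconnected {z : ℂ | z.im = 0} :=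
      (convex_hyperplane (r := 0) Complex.imLm.isLinear).isPreconnected
    rintro (h | h)
    · rw [h, Complex.frontier_setOfPred_lt_im] at hnp
      exact hnp hre
    · rw [h, Complex.frontier_setOfPred_im_lt] at hnp
      exact hnp hre
  have hfr : ((↑) : ℝ → ℂ) '' ((↑) ⁻¹' frontier W) = frontier W := by
    refine image_preimage_eq_of_subset fun z hz => ⟨z.re, ?_⟩
    exact Complex.ext rfl (hf hz).symm
  obtain ⟨a, ha, b, hb, hab, hgap⟩ := exists_gap_of_not_ordConnected
    (isClosed_frontier.preimage Complex.continuous_ofReal) (T := ((↑) : ℝ → ℂ) ⁻¹' frontier W)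
    fun h => hnp (hfr ▸ h.isPreconnected.image _ Complex.continuous_ofReal.continuousOn)
  have hnm : ∀ z, planeFrame p L z ∉ planeFrame p L '' W ↔ z ∈ frontier W := fun z => by
    rw [(planeFrame p L).injective.mem_set_image, ← not_iff_not, not_not]
    exact Set.ext_iff.1 hcompl z
  refine ⟨planeFrame p L a, b - a, sub_pos.2 hab, (hnm _).2 ha, ?_, fun q hq => ?_⟩
  · have : planeFrame p L a + (b - a) • L 1 = planeFrame p L b := by
      simp only [planeFrame_ofReal]
      module
    rw [this]
    exact (hnm _).2 hb
  · obtain ⟨z, rfl⟩ := (planeFrame p L).surjective q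
    have hz := (hnm z).1 hq
    rw [← hfr] at hz
    obtain ⟨t, ht, rfl⟩ := hz
    refine ⟨t - a, (hgap t ht).imp (fun h => ?_) fun h => ?_, ?_⟩
    · linarith
    · linarith
    · simp only [planeFrame_ofReal]
      module

end Shape

section UniquelyDetermined

variable {U V : Set (Euc 2)} {f : HausdorffBoundary U → HausdorffBoundary V}

theorem nonempty_hausdorffBoundary_iff {n : ℕ} {U : Set (Euc n)} (hU : IsOpen U)
    (hne : U.Nonempty) : Nonempty (HausdorffBoundary U) ↔ U ≠ univ := by
  refine ⟨?_, fun h => ?_⟩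
  · rintro ⟨a⟩ rfl
    exact hbSupport_notMem hU a (mem_univ _)
  · obtain ⟨q, hq⟩ := (ne_univ_iff_exists_notMem U).1 h
    obtain ⟨z, hz⟩ := hne
    obtain ⟨a, -⟩ := exists_visible_hbSupport hU hz hq
    exact ⟨a⟩

theorem eq_compl_singleton_of_subsingleton_hausdorffBoundary (hV : IsOpen V) (hne : V.Nonempty)
    [Subsingleton (HausdorffBoundary V)] (ε : HausdorffBoundary V) : V = {hbSupport ε}ᶜ := by
  rw [← compl_inj_iff, compl_compl]
  refine Subset.antisymm (fun q hq => ?_) (singleton_subset_iff.2 (hbSupport_notMem hV ε))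
  by_contra hqe
  obtain ⟨z, hz, hzl⟩ := (dense_compl_lineThrough q (hbSupport ε - q)).inter_open_nonempty V hV hne
  obtain ⟨a, ha, -⟩ := exists_visible_hbSupport hV hz hq
  rw [Subsingleton.elim a ε, mem_segment_iff_wbtw] at ha
  exact hzl (mem_lineThrough_of_wbtw ha.symm fun h => hqe h.symm)

theorem subsingleton_hausdorffBoundary_compl_singleton (p : Euc 2) :
    Subsingleton (HausdorffBoundary ({p}ᶜ : Set (Euc 2))) := by
  obtain ⟨v, hv⟩ := exists_norm_eq (Euc 2) zero_le_one
  have hgap : HasGap {p}ᶜ p v 1 := fun q hq => by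
    rw [mem_compl_iff, not_not, mem_singleton_iff] at hq
    exact ⟨0, Or.inl le_rfl, by simpa using hq⟩
  have hop : IsOpen ({p}ᶜ : Set (Euc 2)) := isOpen_compl_singleton
  have hs : ∀ ε : HausdorffBoundary ({p}ᶜ : Set (Euc 2)), hbSupport ε = p := fun ε =>
    not_not.1 (hbSupport_notMem hop ε)
  refine ⟨fun α β => eq_of_hbDist_eq_zero ?_⟩
  rw [hgap.hbDist_eq hop hv one_pos (hs α), hs, edist_self]

theorem exists_image_eq_of_eq_compl_singleton {p : Euc 2} (hU : U = {p}ᶜ) (hV : IsEucDomain V)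
    (hf : IsHBIsometry f) : ∃ J : Euc 2 ≃ᵢ Euc 2, J '' U = V := by
  subst hU
  have hsub := subsingleton_hausdorffBoundary_compl_singleton p
  obtain ⟨α⟩ := (nonempty_hausdorffBoundary_iff (U := {p}ᶜ) isOpen_compl_singleton
    (nonempty_compl_of_nontrivial p)).2 (by simp)
  have : Subsingleton (HausdorffBoundary V) := hf.1.2.subsingleton
  refine ⟨(IsometryEquiv.subRight p).trans (IsometryEquiv.addLeft (hbSupport (f α))), ?_⟩
  refine Eq.trans ?_
    (eq_compl_singleton_of_subsingleton_hausdorffBoundary hV.1 hV.2.nonempty (f α)).symm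
  rw [image_compl_eq (IsometryEquiv.bijective _), image_singleton]
  simp

theorem uniquelyDeterminedIn_of_frontier (hU : IsEucDomain U)
    (hline : ∃ p v : Euc 2, v ≠ 0 ∧ ∀ x ∈ frontier U, ∃ t : ℝ, x = p + t • v)
    (h : ¬ (IsConnected (frontier U) ∧ (frontier U).Nontrivial)) :
    UniquelyDeterminedIn {V | IsEucDomain V} U := by
  rintro V hV ⟨f, hf⟩
  rcases (frontier U).eq_empty_or_nonempty with hem | hne
  · have hUu : U = univ := (frontier_eq_empty_iff.1 hem).resolve_left hU.2.nonempty.ne_empty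
    have hVu : V = univ := by
      by_contra hV'
      obtain ⟨b⟩ := (nonempty_hausdorffBoundary_iff hV.1 hV.2.nonempty).2 hV'
      obtain ⟨a, -⟩ := hf.1.2 b
      exact (nonempty_hausdorffBoundary_iff hU.1 hU.2.nonempty).1 ⟨a⟩ hUu
    exact ⟨IsometryEquiv.refl _, by
      rw [hUu, hVu, image_univ_of_surjective (IsometryEquiv.surjective _)]⟩
  obtain ⟨p, L, W, rfl, hfr⟩ := exists_planeFrame_of_frontier_subset_line hline
  have hW : IsOpen W := (planeFrame p L).toHomeomorph.isOpen_image.1 hU.1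
  have hWne : W.Nonempty := hU.2.nonempty.of_image
  have hfrU : frontier (planeFrame p L '' W) = planeFrame p L '' frontier W :=
    ((planeFrame p L).toHomeomorph.image_frontier W).symm
  by_cases hpre : IsPreconnected (frontier W)
  · have hconn : IsConnected (frontier (planeFrame p L '' W)) :=
      ⟨hne, hfrU ▸ hpre.image _ (planeFrame p L).continuous.continuousOn⟩
    have hsub : (frontier W).Subsingleton := by
      by_contra hnt
      exact h ⟨hconn, hfrU ▸ (not_subsingleton_iff.1 hnt).image (planeFrame p L).injective⟩
    obtain ⟨w, hw⟩ := (hfrU ▸ hne).of_image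
    have hWc : W = {w}ᶜ := by
      rw [← hsub.eq_singleton_of_mem hw]
      have hnt : ¬ {z : ℂ | z.im = 0}.Subsingleton := fun hs =>
        zero_ne_one (hs (x := 0) (y := 1) Complex.zero_im Complex.one_im)
      refine (eq_compl_frontier_or_eq_halfPlane hW hWne hfr).resolve_right ?_
      rintro (h | h)
      · rw [h, Complex.frontier_setOfPred_lt_im] at hsub
        exact hnt hsub
      · rw [h, Complex.frontier_setOfPred_im_lt] at hsub
        exact hnt hsub
    subst hWc
    have himg : planeFrame p L '' {w}ᶜ = {planeFrame p L w}ᶜ := by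
      rw [image_compl_eq (planeFrame p L).bijective, image_singleton]
    exact exists_image_eq_of_eq_compl_singleton himg hV hf
  · obtain ⟨a, d, hd, ha, hb, hgap⟩ := hasGap_of_not_isPreconnected hW hWne hfr hpre p L
    exact hgap.eq_image_of_isHBIsometry hU.1 hV.1 (by rw [L.norm_map, norm_one]) hd ha hb hf

end UniquelyDetermined

section ComplexModel

variable (F : ℂ ≃ᵢ Euc 2) {W : Set ℂ} {z w : ℂ}

theorem intrinsicDist_image_le_of_lipschitz {γ : ℝ → ℂ} {K : NNReal}
    (hγ : LipschitzOnWith K γ (Icc 0 1)) (hW : MapsTo γ (Icc 0 1) W) :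
    intrinsicDist (F '' W) (F (γ 0)) (F (γ 1)) ≤ K := by
  refine intrinsicDist_le_of_lipschitz (γ := F ∘ γ) ?_ fun t ht => mem_image_of_mem F (hW ht)
  simpa using F.isometry.lipschitz.comp_lipschitzOnWith hγ

theorem intrinsicDist_image_le_of_segment (h : segment ℝ z w ⊆ W) :
    intrinsicDist (F '' W) (F z) (F w) ≤ ENNReal.ofReal (dist z w) := by
  have hl : LipschitzOnWith (nndist z w) (AffineMap.lineMap z w : ℝ → ℂ) (Icc 0 1) := by
    refine LipschitzOnWith.of_dist_le_mul fun s _ t _ => ?_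
    rw [dist_lineMap_lineMap, mul_comm, coe_nndist]
  have := intrinsicDist_image_le_of_lipschitz F hl fun t ht => h (by
    rw [segment_eq_image_lineMap]
    exact ⟨t, ht, rfl⟩)
  rwa [AffineMap.lineMap_apply_zero, AffineMap.lineMap_apply_one, ← edist_nndist,
    edist_dist] at this

theorem exists_hausdorffBoundary_equiv_image (hW : IsOpen W) {X : Type*} [MetricSpace X]
    [CompleteSpace X] (h : ℂ → X) (E : ℂ → ℝ) (hE : Continuous E)
    (hE0 : ∀ q ∈ closure W, q ∉ W → E q = 0)
    (hlow : ∀ u ∈ W, ∃ δ > 0, ∀ v ∈ ball u δ, ∀ w ∈ ball u δ, dist (h v) (h w) ≤ dist v w)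
    (hupp : ∀ z ∈ W, ∀ w ∈ W,
      intrinsicDist (F '' W) (F z) (F w) ≤ ENNReal.ofReal (dist (h z) (h w) + (E z + E w)))
    (hsurj : ∀ x, ∃ s : ℕ → ℂ, (∀ k, s k ∈ W) ∧ (∀ k, h (s k) = x) ∧
      ∃ q ∉ W, Tendsto s atTop (nhds q)) :
    ∃ φ : HausdorffBoundary (F '' W) ≃ X, ∀ a b, edist (φ a) (φ b) = hbDist a b := by
  have hmem : ∀ {q}, q ∈ F '' W ↔ F.symm q ∈ W := fun {q} => by
    rw [← F.preimage_symm]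
    rfl
  have hop : IsOpen (F '' W) := F.toHomeomorph.isOpen_image.2 hW
  refine exists_hausdorffBoundary_equiv hop (h ∘ F.symm)
    (E ∘ F.symm) (hE.comp F.symm.continuous) (fun q hq hqW => ?_) (fun z hz w hw => ?_)
    (fun z hz w hw => ?_) fun x => ?_
  · refine hE0 _ ?_ (fun h => hqW (hmem.2 h))
    have hcl := F.toHomeomorph.image_closure W
    rw [IsometryEquiv.coe_toHomeomorph] at hcl
    rw [← hcl] at hq
    obtain ⟨y, hy, rfl⟩ := hq
    simpa using hy
  · refine edist_le_intrinsicDist_of_local (h ∘ F.symm) fun u hu => ?_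
    obtain ⟨δ, hδ, hloc⟩ := hlow _ (hmem.1 hu)
    have hb : ∀ v ∈ ball u δ, F.symm v ∈ ball (F.symm u) δ := fun v hv => by
      rwa [mem_ball, F.symm.isometry.dist_eq]
    refine ⟨δ, hδ, fun v hv w hw _ _ => ?_⟩
    have := hloc _ (hb v hv) _ (hb w hw)
    rw [F.symm.isometry.dist_eq] at this
    rw [edist_dist, edist_dist]
    exact ENNReal.ofReal_le_ofReal this
  · have := hupp _ (hmem.1 hz) _ (hmem.1 hw)
    rw [F.apply_symm_apply, F.apply_symm_apply] at this
    refine this.trans (ENNReal.ofReal_add_le.trans ?_)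
    rw [← edist_dist]
    exact add_le_add le_rfl ENNReal.ofReal_add_le
  · obtain ⟨s, hs, hx, q, hq, hlim⟩ := hsurj x
    refine ⟨fun k => F (s k), fun k => mem_image_of_mem F (hs k), ?_, F q, ?_, ?_⟩
    · refine tendsto_const_nhds.congr fun k => ?_
      simp [hx k]
    · rwa [F.injective.mem_set_image]
    · exact (F.continuous.tendsto q).comp hlim

theorem tendsto_ofReal_add_mul_I (t c : ℝ) :
    Tendsto (fun k : ℕ => (⟨t, c * (1 / ((k : ℝ) + 1))⟩ : ℂ)) atTop (nhds (t : ℂ)) := by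
  have h := (tendsto_one_div_add_atTop_nhds_zero_nat (𝕜 := ℝ)).const_mul c
  rw [mul_zero] at h
  exact (Complex.equivRealProdCLM.symm.continuous.tendsto (t, 0)).comp
    (tendsto_const_nhds.prodMk_nhds h)

theorem dist_le_abs_re_add_abs_im (z w : ℂ) : dist z w ≤ |z.re - w.re| + |z.im - w.im| := by
  rw [dist_eq_norm]
  exact Complex.norm_le_abs_re_add_abs_im (z - w)

theorem abs_re_sub_le_dist (z w : ℂ) : |z.re - w.re| ≤ dist z w := by
  rw [dist_eq_norm]
  exact Complex.abs_re_le_norm (z - w)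

theorem exists_halfPlane_equiv :
    ∃ φ : HausdorffBoundary (F '' {z | 0 < z.im}) ≃ ℝ,
      ∀ a b, edist (φ a) (φ b) = hbDist a b := by
  refine exists_hausdorffBoundary_equiv_image F (isOpen_lt continuous_const Complex.continuous_im)
    Complex.re (fun z => |z.im|) (by fun_prop) (fun q hq hqW => ?_) (fun u hu => ?_)
    (fun z hz w hw => ?_) fun x => ?_
  · rw [Complex.closure_setOfPred_lt_im] at hq
    rw [abs_eq_zero]
    exact le_antisymm (not_lt.1 hqW) hq
  · exact ⟨1, one_pos, fun v _ w _ => abs_re_sub_le_dist v w⟩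
  · refine (intrinsicDist_image_le_of_segment F
      ((convex_halfSpace_im_gt 0).segment_subset hz hw)).trans (ENNReal.ofReal_le_ofReal ?_)
    exact (dist_le_abs_re_add_abs_im z w).trans (add_le_add_right (abs_sub _ _) _)
  · refine ⟨_, fun k => ?_, fun k => ?_, x, ?_, tendsto_ofReal_add_mul_I x 1⟩
    · change 0 < 1 * (1 / ((k : ℝ) + 1))
      positivity
    · rfl
    · simp

end ComplexModel

section SlitModel

variable (F : ℂ ≃ᵢ Euc 2) {C : Set ℝ} {z w : ℂ}

theorem mem_compl_image_ofReal_of_im_ne_zero (hz : z.im ≠ 0) : z ∈ (Complex.ofReal '' C)ᶜ := by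
  rintro ⟨t, -, rfl⟩
  exact hz (Complex.ofReal_im t)

theorem ofReal_mem_compl_image_ofReal {t : ℝ} :
    (t : ℂ) ∈ (Complex.ofReal '' C)ᶜ ↔ t ∉ C := by
  rw [mem_compl_iff, Complex.ofReal_injective.mem_set_image]

theorem intrinsicDist_image_le_of_same_side {σ : ℝ} (hσ : |σ| = 1)
    (hz : z ∈ (Complex.ofReal '' C)ᶜ) (hw : w ∈ (Complex.ofReal '' C)ᶜ) (hz0 : 0 ≤ σ * z.im)
    (hw0 : 0 ≤ σ * w.im) :
    intrinsicDist (F '' (Complex.ofReal '' C)ᶜ) (F z) (F w) ≤ ENNReal.ofReal (dist z w) := by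
  refine ENNReal.le_of_forall_pos_le_add fun η hη _ => ?_
  have hη' : (0 : ℝ) < η := hη
  have hσ2 : σ * σ = 1 := by rw [← abs_mul_abs_self, hσ, one_mul]
  set e : ℂ := ((σ * (η / 2) : ℝ) : ℂ) * Complex.I with he
  have heim : e.im = σ * (η / 2) := by simp [he]
  have hnorm : ‖e‖ = η / 2 := by
    rw [he, norm_mul, Complex.norm_I, mul_one, Complex.norm_real, norm_mul, Real.norm_eq_abs, hσ,
      one_mul, Real.norm_of_nonneg (by positivity)]
  have hside : ∀ x : ℂ, 0 < σ * x.im → x ∈ (Complex.ofReal '' C)ᶜ := fun x hx =>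
    mem_compl_image_ofReal_of_im_ne_zero fun h => by simp [h] at hx
  have hup : ∀ x : ℂ, 0 ≤ σ * x.im → 0 < σ * (x + e).im := fun x hx => by
    rw [Complex.add_im, heim, mul_add, ← mul_assoc, hσ2]
    positivity
  have hvert : ∀ x : ℂ, x ∈ (Complex.ofReal '' C)ᶜ → 0 ≤ σ * x.im →
      intrinsicDist (F '' (Complex.ofReal '' C)ᶜ) (F x) (F (x + e)) ≤
        ENNReal.ofReal (η / 2) := by
    intro x hx hx0
    refine (intrinsicDist_image_le_of_segment F ?_).trans_eq ?_
    · rw [segment_eq_image_lineMap]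
      rintro _ ⟨r, hr, rfl⟩
      rcases hr.1.eq_or_lt with rfl | hr0
      · simpa using hx
      · refine hside _ ?_
        simp only [AffineMap.lineMap_apply, vsub_eq_sub, add_sub_cancel_left, vadd_eq_add,
          Complex.add_im, Complex.smul_im, heim, smul_eq_mul]
        have : 0 < r * (η / 2) := by positivity
        nlinarith
    · rw [dist_self_add_right, hnorm]
  have hmid : intrinsicDist (F '' (Complex.ofReal '' C)ᶜ) (F (z + e)) (F (w + e)) ≤
      ENNReal.ofReal (dist z w) := by
    refine (intrinsicDist_image_le_of_segment F ?_).trans_eq (by rw [dist_add_right])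
    have hconv : Convex ℝ {x : ℂ | 0 < σ * x.im} :=
      convex_halfSpace_gt (σ • Complex.imLm).isLinear 0
    exact (hconv.segment_subset (hup z hz0) (hup w hw0)).trans hside
  have h1 := hvert z hz hz0
  have h2 := hvert w hw hw0
  rw [intrinsicDist_comm] at h2
  refine (intrinsicDist_triangle.trans (add_le_add h1
    (intrinsicDist_triangle.trans (add_le_add hmid h2)))).trans_eq ?_
  rw [add_left_comm, ← ENNReal.ofReal_add (by positivity) (by positivity), add_halves,
    ENNReal.ofReal_coe_nnreal]

/-- The Hausdorff boundary of the complement of a set `C` of real numbers in the plane, described by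
a retraction `π` onto `C` and a two-sided parametrisation `ι`. -/
theorem exists_slit_equiv {X : Type*} [MetricSpace X] [CompleteSpace X] (hC : IsClosed C)
    (ι : ℝ → X) (π : ℝ → ℝ) (hπC : ∀ t, π t ∈ C) (hπ : ∀ t ∈ C, π t = t)
    (hπl : LipschitzWith 1 π) (hιl : LipschitzWith 1 ι)
    (hglue : ∀ t ∉ C, ι (π t) = ι (-π t))
    (hι : ∀ s ∈ C, ∀ t ∈ C, |s - t| ≤ dist (ι s) (ι t) ∧ |s - t| ≤ dist (ι (-s)) (ι (-t)))
    (hcross : ∀ s ∈ C, ∀ t ∈ C, ∃ u ∈ closure Cᶜ, |s - u| + |t - u| ≤ dist (ι s) (ι (-t)))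
    (hsurj : ∀ x, ∃ t ∈ C, x = ι t ∨ x = ι (-t)) :
    ∃ φ : HausdorffBoundary (F '' (Complex.ofReal '' C)ᶜ) ≃ X,
      ∀ a b, edist (φ a) (φ b) = hbDist a b := by
  have hπd : ∀ s t, |π s - π t| ≤ |s - t| := fun s t => by
    simpa [Real.dist_eq] using hπl.dist_le_mul s t
  have hιd : ∀ s t, dist (ι s) (ι t) ≤ |s - t| := fun s t => by
    simpa [Real.dist_eq] using hιl.dist_le_mul s t
  have hop : IsOpen (Complex.ofReal '' C)ᶜ :=
    (Complex.isometry_ofReal.isClosedEmbedding.isClosedMap C hC).isOpen_compl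
  set h : ℂ → X := fun z => if 0 ≤ z.im then ι (π z.re) else ι (-π z.re) with hh
  have hpos : ∀ z : ℂ, 0 ≤ z.im → h z = ι (π z.re) := fun z hz => if_pos hz
  have hneg : ∀ z : ℂ, z.im < 0 → h z = ι (-π z.re) := fun z hz => if_neg (not_le.2 hz)
  set E : ℂ → ℝ := fun z => |z.re - π z.re| + |z.im|
  have hopp : ∀ z ∈ (Complex.ofReal '' C)ᶜ, ∀ w ∈ (Complex.ofReal '' C)ᶜ, 0 ≤ z.im → w.im < 0 →
      intrinsicDist (F '' (Complex.ofReal '' C)ᶜ) (F z) (F w) ≤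
        ENNReal.ofReal (dist (h z) (h w) + (E z + E w)) := by
    intro z hz w hw hz0 hw0
    rw [hpos z hz0, hneg w hw0]
    refine ENNReal.le_of_forall_pos_le_add fun η hη _ => ?_
    obtain ⟨u, hu, hle⟩ := hcross _ (hπC z.re) _ (hπC w.re)
    obtain ⟨u', hu', hd⟩ := Metric.mem_closure_iff.1 hu (η / 2) (by positivity)
    have hu'W : (u' : ℂ) ∈ (Complex.ofReal '' C)ᶜ := ofReal_mem_compl_image_ofReal.2 hu'
    have h1 := intrinsicDist_image_le_of_same_side F (σ := 1) (by simp) hz hu'W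
      (by simpa using hz0) (by simp)
    have h2 := intrinsicDist_image_le_of_same_side F (σ := -1) (by simp) hu'W hw
      (by simp) (by simpa using hw0.le)
    refine (intrinsicDist_triangle.trans (add_le_add h1 h2)).trans ?_
    rw [← ENNReal.ofReal_add dist_nonneg dist_nonneg, ← ENNReal.ofReal_coe_nnreal,
      ← ENNReal.ofReal_add (by positivity) (by positivity)]
    refine ENNReal.ofReal_le_ofReal ?_
    rw [Real.dist_eq] at hd
    have hb : ∀ x : ℂ, dist x (u' : ℂ) ≤ E x + |π x.re - u| + |u - u'| := fun x => by
      have e1 := dist_le_abs_re_add_abs_im x (u' : ℂ)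
      rw [Complex.ofReal_re, Complex.ofReal_im, sub_zero] at e1
      have e2 := abs_sub_le x.re (π x.re) u'
      have e3 := abs_sub_le (π x.re) u u'
      simp only [E]
      linarith
    have hbz := hb z
    have hbw := hb w
    rw [dist_comm] at hbw
    linarith
  refine exists_hausdorffBoundary_equiv_image F hop h E ?_ (fun q _ hq => ?_) (fun u hu => ?_)
    (fun z hz w hw => ?_) fun x => ?_
  · have := hπl.continuous
    fun_prop
  · rw [mem_compl_iff, not_not] at hq
    obtain ⟨t, ht, rfl⟩ := hq
    simp [E, hπ t ht]
  · obtain ⟨δ, hδ, hball⟩ := Metric.isOpen_iff.1 hop u hu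
    have hopp' : ∀ v ∈ ball u δ, ∀ w ∈ ball u δ, 0 ≤ v.im → w.im < 0 →
        dist (h v) (h w) ≤ dist v w := by
      intro v hv w hw hv0 hw0
      rw [hpos v hv0, hneg w hw0]
      obtain ⟨c, hc, hc0⟩ : ∃ c ∈ segment ℝ v w, c.im = 0 :=
        (convex_segment v w).isPreconnected.intermediate_value (right_mem_segment ℝ v w)
          (left_mem_segment ℝ v w) Complex.continuous_im.continuousOn ⟨hw0.le, hv0⟩
      have hcC : c.re ∉ C := fun h =>
        hball ((convex_ball u δ).segment_subset hv hw hc) ⟨c.re, h, Complex.ext rfl hc0.symm⟩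
      have t1 := (hιd (π v.re) (π c.re)).trans ((hπd _ _).trans (abs_re_sub_le_dist v c))
      have t2 : dist (ι (-π c.re)) (ι (-π w.re)) ≤ dist c w := by
        refine (hιd _ _).trans ?_
        rw [neg_sub_neg, abs_sub_comm]
        exact (hπd _ _).trans (abs_re_sub_le_dist c w)
      rw [← hglue _ hcC] at t2
      have t3 := dist_add_dist_of_mem_segment hc
      have t4 := dist_triangle (ι (π v.re)) (ι (π c.re)) (ι (-π w.re))
      linarith
    refine ⟨δ, hδ, fun v hv w hw => ?_⟩
    rcases le_or_gt 0 v.im with hv0 | hv0 <;> rcases le_or_gt 0 w.im with hw0 | hw0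
    · rw [hpos v hv0, hpos w hw0]
      exact (hιd _ _).trans ((hπd _ _).trans (abs_re_sub_le_dist v w))
    · exact hopp' v hv w hw hv0 hw0
    · rw [dist_comm, dist_comm v]
      exact hopp' w hw v hv hw0 hv0
    · rw [hneg v hv0, hneg w hw0]
      refine (hιd _ _).trans ?_
      rw [neg_sub_neg, abs_sub_comm]
      exact (hπd _ _).trans (abs_re_sub_le_dist v w)
  · have hsame : |π z.re - π w.re| ≤ dist (h z) (h w) →
        dist z w ≤ dist (h z) (h w) + (E z + E w) := fun hle => by
      have e1 := dist_le_abs_re_add_abs_im z w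
      have e2 := abs_sub_le z.re (π z.re) w.re
      have e3 := abs_sub_le (π z.re) (π w.re) w.re
      rw [abs_sub_comm (π w.re)] at e3
      have e4 := abs_sub z.im w.im
      simp only [E]
      linarith
    rcases le_or_gt 0 z.im with hz0 | hz0 <;> rcases le_or_gt 0 w.im with hw0 | hw0
    · refine (intrinsicDist_image_le_of_same_side F (σ := 1) (by simp) hz hw (by simpa using hz0)
        (by simpa using hw0)).trans (ENNReal.ofReal_le_ofReal (hsame ?_))
      rw [hpos z hz0, hpos w hw0]
      exact (hι _ (hπC _) _ (hπC _)).1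
    · exact hopp z hz w hw hz0 hw0
    · rw [intrinsicDist_comm, dist_comm, add_comm (E z)]
      exact hopp w hw z hz hw0 hz0
    · refine (intrinsicDist_image_le_of_same_side F (σ := -1) (by simp) hz hw
        (by simpa using hz0.le)
        (by simpa using hw0.le)).trans (ENNReal.ofReal_le_ofReal (hsame ?_))
      rw [hneg z hz0, hneg w hw0]
      exact (hι _ (hπC _) _ (hπC _)).2
  · obtain ⟨t, ht, hx⟩ := hsurj x
    have hq : (t : ℂ) ∉ (Complex.ofReal '' C)ᶜ := fun hn => ofReal_mem_compl_image_ofReal.1 hn ht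
    have hc : ∀ (c : ℝ) (k : ℕ), c ≠ 0 →
        (⟨t, c * (1 / ((k : ℝ) + 1))⟩ : ℂ) ∈ (Complex.ofReal '' C)ᶜ := fun c k hc =>
      mem_compl_image_ofReal_of_im_ne_zero (mul_ne_zero hc (by positivity))
    rcases hx with rfl | rfl
    · refine ⟨_, fun k => hc 1 k one_ne_zero, fun k => ?_, t, hq, tendsto_ofReal_add_mul_I t 1⟩
      rw [hpos, hπ t ht]
      change 0 ≤ 1 * (1 / ((k : ℝ) + 1))
      positivity
    · refine ⟨_, fun k => hc (-1) k (by norm_num), fun k => ?_, t, hq,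
        tendsto_ofReal_add_mul_I t (-1)⟩
      rw [hneg, hπ t ht]
      change -1 * (1 / ((k : ℝ) + 1)) < 0
      rw [neg_one_mul, neg_lt_zero]
      positivity

end SlitModel

section Slits

variable (F : ℂ ≃ᵢ Euc 2)

theorem exists_halfLine_compl_equiv :
    ∃ φ : HausdorffBoundary (F '' (Complex.ofReal '' Iic 0)ᶜ) ≃ ℝ,
      ∀ a b, edist (φ a) (φ b) = hbDist a b := by
  refine exists_slit_equiv F isClosed_Iic id (fun t => min t 0) (fun t => min_le_right t 0)
    (fun t ht => min_eq_left ht) (LipschitzWith.id.min_const 0) LipschitzWith.id (fun t ht => ?_)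
    (fun s _ t _ => ?_) (fun s hs t ht => ⟨0, ?_, ?_⟩) fun x => ?_
  · rw [min_eq_right (not_le.1 ht).le, neg_zero]
  · rw [id, id, id, id, Real.dist_eq, Real.dist_eq, neg_sub_neg, abs_sub_comm t]
    exact ⟨le_rfl, le_rfl⟩
  · rw [compl_Iic, closure_Ioi]
    exact self_mem_Ici
  · rw [mem_Iic] at hs ht
    rw [id, id, Real.dist_eq, sub_zero, sub_zero, sub_neg_eq_add, abs_of_nonpos hs,
      abs_of_nonpos ht, abs_of_nonpos (by linarith)]
    linarith
  · rcases le_total x 0 with hx | hx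
    · exact ⟨x, hx, Or.inl rfl⟩
    · exact ⟨-x, neg_nonpos.2 hx, Or.inr (by simp)⟩

theorem dist_coe_addCircle (p s t : ℝ) :
    dist (s : AddCircle p) (t : AddCircle p) = ‖((s - t : ℝ) : AddCircle p)‖ := by
  rw [dist_eq_norm, AddCircle.coe_sub]

theorem norm_coe_addCircle_of_abs_le {p t : ℝ} (hp : 0 < p) (h : |t| ≤ p / 2) :
    ‖(t : AddCircle p)‖ = |t| :=
  (AddCircle.norm_coe_eq_abs_iff p hp.ne').2 (by rwa [abs_of_pos hp])

theorem exists_segment_compl_equiv {ℓ : ℝ} (hℓ : 0 < ℓ) :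
    ∃ φ : HausdorffBoundary (F '' (Complex.ofReal '' Icc 0 ℓ)ᶜ) ≃ AddCircle (2 * ℓ),
      ∀ a b, edist (φ a) (φ b) = hbDist a b := by
  have hp : 0 < 2 * ℓ := by positivity
  have : Fact (0 < 2 * ℓ) := ⟨hp⟩
  have hnorm : ∀ {t : ℝ}, |t| ≤ ℓ → ‖(t : AddCircle (2 * ℓ))‖ = |t| := fun h =>
    norm_coe_addCircle_of_abs_le hp (by linarith)
  refine exists_slit_equiv F isClosed_Icc (fun t => (t : AddCircle (2 * ℓ)))
    (fun t => projIcc 0 ℓ hℓ.le t) (fun t => (projIcc 0 ℓ hℓ.le t).2)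
    (fun t ht => by rw [projIcc_of_mem hℓ.le ht])
    (LipschitzWith.subtype_val _ |>.comp (LipschitzWith.projIcc hℓ.le) |>.weaken (by simp))
    (LipschitzWith.of_dist_le_mul fun s t => ?_) (fun t ht => ?_)
    (fun s hs t ht => ?_) (fun s hs t ht => ?_) fun x => ?_
  · rw [dist_coe_addCircle, NNReal.coe_one, one_mul, Real.dist_eq]
    exact QuotientAddGroup.norm_mk_le_norm
  · rw [mem_Icc, not_and_or, not_le, not_le] at ht
    rcases ht with ht | ht
    · simp [projIcc_of_le_left hℓ.le ht.le]
    · simp only [projIcc_of_right_le hℓ.le ht.le]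
      rw [← sub_eq_zero, ← AddCircle.coe_sub, sub_neg_eq_add, ← two_mul]
      exact AddCircle.coe_period _
  · have h1 : |s - t| ≤ ℓ := abs_sub_le_iff.2 ⟨by linarith [hs.2, ht.1], by linarith [hs.1, ht.2]⟩
    have h2 : |-s - -t| = |s - t| := by rw [neg_sub_neg, abs_sub_comm]
    rw [dist_coe_addCircle, dist_coe_addCircle, hnorm h1, hnorm (h2 ▸ h1), h2]
    exact ⟨le_rfl, le_rfl⟩
  · have hcl : ∀ u ∈ ({0, ℓ} : Set ℝ), u ∈ closure (Icc 0 ℓ)ᶜ := by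
      intro u hu
      rw [closure_compl, interior_Icc]
      rcases hu with rfl | rfl <;> simp
    rw [dist_coe_addCircle, sub_neg_eq_add]
    rcases le_total (s + t) ℓ with h | h
    · refine ⟨0, hcl 0 (by simp), ?_⟩
      have h0 : 0 ≤ s + t := add_nonneg hs.1 ht.1
      rw [hnorm (by rwa [abs_of_nonneg h0]), sub_zero, sub_zero, abs_of_nonneg hs.1,
        abs_of_nonneg ht.1, abs_of_nonneg h0]
    · refine ⟨ℓ, hcl ℓ (by simp), ?_⟩
      have e : ((s + t : ℝ) : AddCircle (2 * ℓ)) = ((s + t - 2 * ℓ : ℝ) : AddCircle (2 * ℓ)) := by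
        rw [AddCircle.coe_sub _ (s + t), AddCircle.coe_period, sub_zero]
      have h0 : s + t - 2 * ℓ ≤ 0 := by linarith [hs.2, ht.2]
      rw [e, hnorm (by rw [abs_of_nonpos h0]; linarith), abs_of_nonpos h0,
        abs_of_nonpos (by linarith [hs.2]), abs_of_nonpos (by linarith [ht.2])]
      linarith
  · have hx : x ∈ QuotientAddGroup.mk '' Ioc (-ℓ) (-ℓ + 2 * ℓ) := by
      rw [AddCircle.coe_image_Ioc_eq]
      exact mem_univ x
    obtain ⟨y, hy, rfl⟩ := hx
    rcases le_total 0 y with h | h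
    · exact ⟨y, ⟨h, by linarith [hy.2]⟩, Or.inl rfl⟩
    · exact ⟨-y, ⟨by linarith, by linarith [hy.1]⟩, Or.inr (by rw [neg_neg])⟩

end Slits

section DiscExterior

variable (F : ℂ ≃ᵢ Euc 2) {r : ℝ} {z w : ℂ}

theorem coe_mul_eq_of_angle_eq {a b : ℝ} (h : (a : Real.Angle) = b) :
    ((r * a : ℝ) : AddCircle (2 * (r * Real.pi))) =
      ((r * b : ℝ) : AddCircle (2 * (r * Real.pi))) := by
  obtain ⟨k, hk⟩ := Real.Angle.angle_eq_iff_two_pi_dvd_sub.1 h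
  rw [← sub_eq_zero, ← AddCircle.coe_sub, AddCircle.coe_eq_zero_iff]
  refine ⟨k, ?_⟩
  rw [← mul_sub, hk, zsmul_eq_mul]
  ring

theorem dist_coe_mul_arg (hr : 0 < r) (hz : z ≠ 0) (hw : w ≠ 0) :
    dist ((r * z.arg : ℝ) : AddCircle (2 * (r * Real.pi)))
      ((r * w.arg : ℝ) : AddCircle (2 * (r * Real.pi))) = r * |(z / w).arg| := by
  rw [dist_coe_addCircle, ← mul_sub, coe_mul_eq_of_angle_eq (b := (z / w).arg),
    norm_coe_addCircle_of_abs_le (by positivity), abs_mul, abs_of_pos hr]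
  · rw [mul_div_cancel_left₀ _ two_ne_zero, abs_mul, abs_of_pos hr]
    exact mul_le_mul_of_nonneg_left (Complex.abs_arg_le_pi _) hr.le
  · rw [Complex.arg_div_coe_angle hz hw, Real.Angle.coe_sub]

theorem mul_abs_arg_div_le_dist (hr : 0 < r) (hw : r < ‖w‖) (h : dist z w ≤ (‖w‖ - r) / 2) :
    r * |(z / w).arg| ≤ dist z w := by
  have hw0 : 0 < ‖w‖ := hr.trans hw
  have hx : ‖z / w - 1‖ * ‖w‖ = dist z w := by
    rw [← norm_mul, sub_mul, div_mul_cancel₀ _ (norm_pos_iff.1 hw0), one_mul, dist_eq_norm]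
  set x := z / w - 1 with hxd
  have hx2 : ‖x‖ ≤ 1 / 2 := by
    by_contra! hlt
    nlinarith
  have hlog : |(z / w).arg| ≤ ‖x‖ * (1 + ‖x‖) := by
    have h1 := Complex.norm_log_one_add_le (z := x) (by linarith)
    have h2 : (1 - ‖x‖)⁻¹ ≤ 2 := by
      rw [inv_le_comm₀ (by linarith) two_pos]
      linarith
    have h3 := mul_le_mul_of_nonneg_left h2 (sq_nonneg ‖x‖)
    rw [← Complex.log_im, show z / w = 1 + x by rw [hxd]; ring]
    exact (Complex.abs_im_le_norm _).trans (h1.trans (by nlinarith))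
  have hx0 := norm_nonneg x
  have hrx : r * (1 + ‖x‖) ≤ ‖w‖ := by nlinarith
  calc r * |(z / w).arg| ≤ r * (‖x‖ * (1 + ‖x‖)) := mul_le_mul_of_nonneg_left hlog hr.le
    _ = ‖x‖ * (r * (1 + ‖x‖)) := by ring
    _ ≤ ‖x‖ * ‖w‖ := mul_le_mul_of_nonneg_left hrx hx0
    _ = dist z w := hx

theorem intrinsicDist_image_discExterior_le (hr : 0 < r) (hz : r < ‖z‖) (hw : r < ‖w‖) :
    intrinsicDist (F '' {z | r < ‖z‖}) (F z) (F w) ≤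
      ENNReal.ofReal (r * |(z / w).arg| +
        ((1 + Real.pi) * (‖z‖ - r) + (1 + Real.pi) * (‖w‖ - r))) := by
  have hz0 : z ≠ 0 := norm_pos_iff.1 (hr.trans hz)
  have hw0 : w ≠ 0 := norm_pos_iff.1 (hr.trans hw)
  set θ := (w / z).arg with hθ
  have hθπ : |θ| ≤ Real.pi := Complex.abs_arg_le_pi _
  have harg : |(z / w).arg| = |θ| := by
    rw [hθ, ← inv_div, Complex.abs_arg_inv]
  set R : ℝ → ℝ := fun t => ‖z‖ + t * (‖w‖ - ‖z‖) with hR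
  set γ : ℝ → ℂ := fun t => z / ‖z‖ * (R t * Complex.exp (Complex.I * (t * θ : ℝ))) with hγ
  have hu : ‖z / ‖z‖‖ = 1 := by simp [hz0]
  have hexp : ∀ t : ℝ, ‖Complex.exp (Complex.I * (t : ℂ))‖ = 1 := fun t => by
    rw [mul_comm, Complex.norm_exp_ofReal_mul_I]
  have hRmem : ∀ t ∈ Icc (0 : ℝ) 1, r < R t ∧ R t ≤ ‖z‖ + ‖w‖ - r := fun t ht => by
    have h1 : R t = (1 - t) * ‖z‖ + t * ‖w‖ := by simp only [hR]; ring
    rw [h1]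
    constructor <;> nlinarith [ht.1, ht.2, mul_nonneg ht.1 (sub_nonneg.2 hw.le),
      mul_nonneg (sub_nonneg.2 ht.2) (sub_nonneg.2 hz.le),
      mul_nonneg ht.1 (sub_nonneg.2 hz.le), mul_nonneg (sub_nonneg.2 ht.2) (sub_nonneg.2 hw.le)]
  have hK : 0 ≤ |‖w‖ - ‖z‖| + (‖z‖ + ‖w‖ - r) * |θ| :=
    add_nonneg (abs_nonneg _) (mul_nonneg (by linarith) (abs_nonneg _))
  have hlip : LipschitzOnWith (|‖w‖ - ‖z‖| + (‖z‖ + ‖w‖ - r) * |θ|).toNNReal γ (Icc 0 1) := by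
    refine LipschitzOnWith.of_dist_le_mul fun s hs t ht => ?_
    have e : γ s - γ t = z / ‖z‖ * ((((s - t) * (‖w‖ - ‖z‖) : ℝ) : ℂ) *
        Complex.exp (Complex.I * (s * θ : ℝ)) + R t * (Complex.exp (Complex.I * (t * θ : ℝ)) *
          (Complex.exp (Complex.I * ((s - t) * θ : ℝ)) - 1))) := by
      have : Complex.exp (Complex.I * (s * θ : ℝ)) = Complex.exp (Complex.I * (t * θ : ℝ)) *
          Complex.exp (Complex.I * ((s - t) * θ : ℝ)) := by
        rw [← Complex.exp_add]
        push_cast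
        ring_nf
      simp only [hγ, hR, this]
      push_cast
      ring
    have hexp' := Real.norm_exp_I_mul_ofReal_sub_one_le (x := (s - t) * θ)
    rw [Real.norm_eq_abs, abs_mul] at hexp'
    rw [dist_eq_norm, e, norm_mul, hu, one_mul, Real.coe_toNNReal _ hK, Real.dist_eq]
    refine (norm_add_le _ _).trans ?_
    rw [norm_mul, norm_mul, norm_mul, hexp, hexp, one_mul, mul_one, Complex.norm_real,
      Complex.norm_real, Real.norm_eq_abs, Real.norm_eq_abs, abs_mul,
      abs_of_pos (hr.trans (hRmem t ht).1)]
    calc _ ≤ |s - t| * |‖w‖ - ‖z‖| + (‖z‖ + ‖w‖ - r) * (|s - t| * |θ|) :=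
          add_le_add_right (mul_le_mul (hRmem t ht).2 hexp' (norm_nonneg _) (by linarith)) _
      _ = _ := by ring
  have hmaps : MapsTo γ (Icc 0 1) {z | r < ‖z‖} := fun t ht => by
    have := (hRmem t ht).1
    rwa [mem_ofPred_eq, norm_mul, hu, one_mul, norm_mul, hexp, mul_one, Complex.norm_real,
      Real.norm_eq_abs, abs_of_pos (hr.trans this)]
  have hnz : (‖z‖ : ℂ) ≠ 0 := by simpa using hz0
  have h0 : γ 0 = z := by
    simp only [hγ, hR, zero_mul, add_zero, Complex.ofReal_zero, mul_zero, Complex.exp_zero, mul_one]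
    exact div_mul_cancel₀ z hnz
  have h1 : γ 1 = w := by
    have hp := Complex.norm_mul_exp_arg_mul_I (w / z)
    rw [norm_div, Complex.ofReal_div, ← hθ] at hp
    simp only [hγ, hR, one_mul, add_sub_cancel]
    rw [mul_comm Complex.I]
    calc _ = z * (‖w‖ / ‖z‖ * Complex.exp (θ * Complex.I)) := by ring
      _ = w := by rw [hp, mul_div_cancel₀ _ hz0]
  have := intrinsicDist_image_le_of_lipschitz F hlip hmaps
  rw [h0, h1] at this
  refine this.trans ?_
  rw [harg]
  refine ENNReal.ofReal_le_ofReal ?_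
  have h2 : |‖w‖ - ‖z‖| ≤ ‖z‖ + ‖w‖ - 2 * r := abs_sub_le_iff.2 ⟨by linarith, by linarith⟩
  have h3 := mul_le_mul_of_nonneg_left hθπ (show 0 ≤ ‖z‖ + ‖w‖ - 2 * r by linarith)
  linarith

theorem exists_discExterior_equiv (hr : 0 < r) :
    ∃ φ : HausdorffBoundary (F '' {z | r < ‖z‖}) ≃ AddCircle (2 * (r * Real.pi)),
      ∀ a b, edist (φ a) (φ b) = hbDist a b := by
  have : Fact (0 < 2 * (r * Real.pi)) := ⟨by positivity⟩
  have hne : ∀ {z : ℂ}, r < ‖z‖ → z ≠ 0 := fun h => norm_pos_iff.1 (hr.trans h)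
  refine exists_hausdorffBoundary_equiv_image F (isOpen_lt continuous_const continuous_norm)
    (fun z => ((r * z.arg : ℝ) : AddCircle (2 * (r * Real.pi))))
    (fun z => (1 + Real.pi) * (‖z‖ - r)) (by fun_prop) (fun q hq hqW => ?_) (fun u hu => ?_)
    (fun z hz w hw => ?_) fun x => ?_
  · have hle : r ≤ ‖q‖ := closure_lt_subset_le continuous_const continuous_norm hq
    rw [le_antisymm (not_lt.1 hqW) hle, sub_self, mul_zero]
  · rw [mem_ofPred_eq] at hu
    refine ⟨(‖u‖ - r) / 8, by linarith, fun v hv w hw => ?_⟩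
    have hnear : ∀ {v}, v ∈ ball u ((‖u‖ - r) / 8) → 7 / 8 * (‖u‖ - r) < ‖v‖ - r := fun {v} hv => by
      rw [mem_ball, dist_comm, dist_eq_norm] at hv
      linarith [norm_sub_norm_le u v]
    have hv' := hnear hv
    have hw' := hnear hw
    rw [dist_coe_mul_arg hr (hne (by linarith)) (hne (by linarith))]
    refine mul_abs_arg_div_le_dist hr (by linarith) ?_
    rw [mem_ball] at hv hw
    linarith [dist_triangle_right v w u]
  · rw [dist_coe_mul_arg hr (hne hz) (hne hw)]
    exact intrinsicDist_image_discExterior_le F hr hz hw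
  · obtain ⟨y, rfl⟩ := QuotientAddGroup.mk_surjective x
    set e : ℂ := Real.Angle.cos (y / r : ℝ) + Real.Angle.sin (y / r : ℝ) * Complex.I with he
    have hen : ‖e‖ = 1 := by
      rw [he, Real.Angle.cos_coe, Real.Angle.sin_coe]
      simpa using Complex.norm_cos_add_sin_mul_I (y / r)
    have hnorm : ∀ {R : ℝ}, 0 < R → ‖(R : ℂ) * e‖ = R := fun h => by
      rw [norm_mul, hen, mul_one, Complex.norm_of_nonneg h.le]
    have hpos : ∀ k : ℕ, 0 < 1 / ((k : ℝ) + 1) := fun k => by positivity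
    have hlim := (tendsto_one_div_add_atTop_nhds_zero_nat (𝕜 := ℝ)).const_add r
    rw [add_zero] at hlim
    refine ⟨fun k => ((r + 1 / ((k : ℝ) + 1) : ℝ) : ℂ) * e, fun k => ?_, fun k => ?_,
      (r : ℂ) * e, ?_, ((Complex.continuous_ofReal.tendsto r).comp hlim).mul_const _⟩
    · rw [mem_ofPred_eq, hnorm (add_pos hr (hpos k))]
      exact lt_add_of_pos_right r (hpos k)
    · refine (coe_mul_eq_of_angle_eq (Complex.arg_mul_cos_add_sin_mul_I_coe_angle
        (add_pos hr (hpos k)) (y / r : ℝ))).trans ?_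
      rw [mul_div_cancel₀ y hr.ne']
    · rw [mem_ofPred_eq, hnorm hr]
      exact lt_irrefl r

end DiscExterior

section NotUniquelyDetermined

theorem not_uniquelyDeterminedIn_of_equiv (F : ℂ ≃ᵢ Euc 2) {A B : Set ℂ} {X : Type*} [MetricSpace X]
    (hA : ∃ φ : HausdorffBoundary (F '' A) ≃ X, ∀ a b, edist (φ a) (φ b) = hbDist a b)
    (hB : ∃ φ : HausdorffBoundary (F '' B) ≃ X, ∀ a b, edist (φ a) (φ b) = hbDist a b)
    (hop : IsOpen B) (hconn : IsConnected B) (hd : ¬ (Dense A ↔ Dense B)) :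
    ¬ UniquelyDeterminedIn {V | IsEucDomain V} (F '' A) := by
  intro hU
  obtain ⟨J, hJ⟩ := hU (F '' B) ⟨F.toHomeomorph.isOpen_image.2 hop,
    hconn.image _ F.continuous.continuousOn⟩ (exists_isHBIsometry_of_equiv hA hB)
  have hdense : ∀ (G : ℂ ≃ᵢ Euc 2) (D : Set ℂ), Dense (G '' D) ↔ Dense D := fun G D => by
    have := G.toHomeomorph.image_closure D
    rw [IsometryEquiv.coe_toHomeomorph] at this
    rw [dense_iff_closure_eq, dense_iff_closure_eq, ← this,
      ← image_univ_of_surjective G.surjective, G.injective.image_injective.eq_iff]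
  rw [← image_comp] at hJ
  exact hd ((hdense (F.trans J) A).symm.trans (by rw [← hdense F B, ← hJ]; rfl))

theorem dense_compl_image_ofReal (C : Set ℝ) : Dense (Complex.ofReal '' C)ᶜ := by
  refine ((dense_compl_singleton (0 : ℝ)).preimage Complex.isOpenMap_im).mono ?_
  rintro z hz ⟨t, -, rfl⟩
  exact hz (Complex.ofReal_im t)

theorem not_dense_halfPlane : ¬ Dense {z : ℂ | 0 < z.im} := fun h => by
  have := h (-Complex.I)
  rw [Complex.closure_setOfPred_lt_im] at this
  norm_num at this

theorem not_dense_discExterior {r : ℝ} (hr : 0 < r) : ¬ Dense {z : ℂ | r < ‖z‖} := fun h => by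
  have := closure_lt_subset_le continuous_const continuous_norm (h 0)
  rw [mem_ofPred_eq, norm_zero] at this
  exact hr.not_ge this

theorem isConnected_halfPlane : IsConnected {z : ℂ | 0 < z.im} :=
  (convex_halfSpace_im_gt 0).isConnected ⟨Complex.I, by simp⟩

theorem compl_image_ofReal_Iic : (Complex.ofReal '' Iic 0)ᶜ = Complex.slitPlane := by
  ext z
  rw [Complex.mem_slitPlane_iff, ← not_iff_not, mem_compl_iff, not_not, not_or, not_lt, not_not]
  constructor
  · rintro ⟨t, ht, rfl⟩
    exact ⟨ht, Complex.ofReal_im t⟩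
  · rintro ⟨h1, h2⟩
    exact ⟨z.re, h1, Complex.ext rfl h2.symm⟩

theorem isConnected_slitPlane : IsConnected Complex.slitPlane :=
  (Complex.starConvex_one_slitPlane.isPathConnected Complex.one_mem_slitPlane).isConnected

theorem isConnected_discExterior {r : ℝ} (hr : 0 < r) : IsConnected {z : ℂ | r < ‖z‖} := by
  have h : {z : ℂ | r < ‖z‖} =
      (fun q : ℝ × ℝ => (q.1 : ℂ) * Complex.exp (q.2 * Complex.I)) '' Ioi r ×ˢ univ := by
    ext z
    constructor
    · exact fun hz => ⟨(‖z‖, z.arg), ⟨hz, mem_univ _⟩, Complex.norm_mul_exp_arg_mul_I z⟩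
    · rintro ⟨⟨R, t⟩, ⟨hR, -⟩, rfl⟩
      rw [mem_Ioi] at hR
      rw [mem_ofPred_eq, norm_mul, Complex.norm_exp_ofReal_mul_I, mul_one,
        Complex.norm_of_nonneg (hr.trans hR).le]
      exact hR
  rw [h]
  exact (isConnected_Ioi.prod isConnected_univ).image _ (by fun_prop)

theorem not_uniquelyDeterminedIn_halfPlane (F : ℂ ≃ᵢ Euc 2) :
    ¬ UniquelyDeterminedIn {V | IsEucDomain V} (F '' {z | 0 < z.im}) :=
  not_uniquelyDeterminedIn_of_equiv F (exists_halfPlane_equiv F) (exists_halfLine_compl_equiv F)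
    (compl_image_ofReal_Iic ▸ Complex.isOpen_slitPlane)
    (compl_image_ofReal_Iic ▸ isConnected_slitPlane)
    fun h => not_dense_halfPlane (h.2 (dense_compl_image_ofReal _))

theorem not_uniquelyDeterminedIn_halfLine_compl (F : ℂ ≃ᵢ Euc 2) :
    ¬ UniquelyDeterminedIn {V | IsEucDomain V} (F '' (Complex.ofReal '' Iic 0)ᶜ) :=
  not_uniquelyDeterminedIn_of_equiv F (exists_halfLine_compl_equiv F) (exists_halfPlane_equiv F)
    (isOpen_lt continuous_const Complex.continuous_im) isConnected_halfPlane
    fun h => not_dense_halfPlane (h.1 (dense_compl_image_ofReal _))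

theorem not_uniquelyDeterminedIn_segment_compl (F : ℂ ≃ᵢ Euc 2) {ℓ : ℝ} (hℓ : 0 < ℓ) :
    ¬ UniquelyDeterminedIn {V | IsEucDomain V} (F '' (Complex.ofReal '' Icc 0 ℓ)ᶜ) := by
  have hr : 0 < ℓ / Real.pi := by positivity
  have hE := exists_discExterior_equiv F hr
  rw [div_mul_cancel₀ ℓ Real.pi_ne_zero] at hE
  exact not_uniquelyDeterminedIn_of_equiv F (exists_segment_compl_equiv F hℓ) hE
    (isOpen_lt continuous_const continuous_norm) (isConnected_discExterior hr)
    fun h => not_dense_discExterior hr (h.1 (dense_compl_image_ofReal _))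

theorem IsClosed.eq_ordConnected_cases {T : Set ℝ} (hT : IsClosed T) (ho : T.OrdConnected)
    (hne : T.Nonempty) :
    T = univ ∨ (∃ b, T = Iic b) ∨ (∃ a, T = Ici a) ∨ ∃ a b, T = Icc a b := by
  by_cases hA : BddAbove T <;> by_cases hB : BddBelow T
  · refine Or.inr (Or.inr (Or.inr ⟨sInf T, sSup T, ?_⟩))
    exact Subset.antisymm (fun t ht => ⟨csInf_le hB ht, le_csSup hA ht⟩)
      (ho.out (hT.csInf_mem hne hB) (hT.csSup_mem hne hA))
  · refine Or.inr (Or.inl ⟨sSup T, Subset.antisymm (fun t ht => le_csSup hA ht) fun t ht => ?_⟩)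
    obtain ⟨s, hs, hst⟩ := not_bddBelow_iff.1 hB t
    exact ho.out hs (hT.csSup_mem hne hA) ⟨hst.le, ht⟩
  · refine Or.inr (Or.inr (Or.inl ⟨sInf T, Subset.antisymm (fun t ht => csInf_le hB ht)
      fun t ht => ?_⟩))
    obtain ⟨s, hs, hst⟩ := not_bddAbove_iff.1 hA t
    exact ho.out (hT.csInf_mem hne hB) hs ⟨ht, hst.le⟩
  · refine Or.inl (eq_univ_of_forall fun t => ?_)
    obtain ⟨s, hs, hst⟩ := not_bddBelow_iff.1 hB t
    obtain ⟨u, hu, htu⟩ := not_bddAbove_iff.1 hA t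
    exact ho.out hs hu ⟨hst.le, htu.le⟩

theorem image_trans_compl_image_ofReal (F : ℂ ≃ᵢ Euc 2) (G : ℂ ≃ᵢ ℂ) (g : ℝ → ℝ)
    (hG : ∀ t : ℝ, G t = g t) {S T : Set ℝ} (hST : g '' S = T) :
    F '' (Complex.ofReal '' T)ᶜ = (G.trans F) '' (Complex.ofReal '' S)ᶜ := by
  change _ = (F ∘ G) '' _
  rw [image_comp, image_compl_eq G.bijective, ← hST, image_image,
    image_image]
  simp_rw [hG]

theorem not_uniquelyDeterminedIn_of_frontier {U : Set (Euc 2)} (hU : IsEucDomain U)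
    (hline : ∃ p v : Euc 2, v ≠ 0 ∧ ∀ x ∈ frontier U, ∃ t : ℝ, x = p + t • v)
    (hc : IsConnected (frontier U)) (hnt : (frontier U).Nontrivial) :
    ¬ UniquelyDeterminedIn {V | IsEucDomain V} U := by
  obtain ⟨p, L, W, rfl, hfr⟩ := exists_planeFrame_of_frontier_subset_line hline
  generalize planeFrame p L = F at *
  have hW : IsOpen W := F.toHomeomorph.isOpen_image.1 hU.1
  have hWne : W.Nonempty := hU.2.nonempty.of_image
  have hWc : IsPreconnected W := F.toHomeomorph.isPreconnected_image.1 hU.2.isPreconnected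
  have hfrU : frontier (F '' W) = F '' frontier W := (F.toHomeomorph.image_frontier W).symm
  rw [hfrU] at hc hnt
  have hcW : IsPreconnected (frontier W) := F.toHomeomorph.isPreconnected_image.1 hc.isPreconnected
  have hntW : (frontier W).Nontrivial := nontrivial_of_image F _ hnt
  rcases eq_compl_frontier_or_eq_halfPlane hW hWne hfr with h | h | h
  · have hT : frontier W = Complex.ofReal '' (Complex.re '' frontier W) := by
      rw [image_image]
      refine (image_congr fun z hz => ?_).trans (image_id _) |>.symm
      exact Complex.ext rfl (hfr hz).symm
    set T := Complex.re '' frontier W with hTd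
    have hTcl : IsClosed T := by
      have : T = Complex.ofReal ⁻¹' frontier W := by
        rw [hT, preimage_image_eq _ Complex.ofReal_injective]
      rw [this]
      exact isClosed_frontier.preimage Complex.continuous_ofReal
    have hTo : T.OrdConnected :=
      (hcW.image _ Complex.continuous_re.continuousOn).ordConnected
    have hTnt : T.Nontrivial := by
      rw [hT] at hntW
      exact nontrivial_of_image _ _ hntW
    rw [hT] at h
    rcases hTcl.eq_ordConnected_cases hTo hTnt.nonempty with
      hTu | ⟨b, hTb⟩ | ⟨a, hTa⟩ | ⟨a, b, hTab⟩
    · rw [hTu] at h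
      have hmem : ∀ z : ℂ, z.im ≠ 0 → z ∈ W := fun z hz => by
        rw [h]
        rintro ⟨t, -, rfl⟩
        exact hz (Complex.ofReal_im t)
      obtain ⟨z, hz, hz0⟩ := hWc.intermediate_value (hmem (-Complex.I) (by simp))
        (hmem Complex.I (by simp)) Complex.continuous_im.continuousOn
        (show (0 : ℝ) ∈ Icc _ _ by simp)
      rw [h] at hz
      exact (hz ⟨z.re, mem_univ _, Complex.ext rfl hz0.symm⟩).elim
    · rw [h, hTb, image_trans_compl_image_ofReal F (IsometryEquiv.addRight (b : ℂ)) (· + b)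
        (fun t => by simp) (S := Iic 0) (by simp)]
      exact not_uniquelyDeterminedIn_halfLine_compl _
    · rw [h, hTa, image_trans_compl_image_ofReal F (IsometryEquiv.subLeft (a : ℂ)) (a - ·)
        (fun t => by simp) (S := Iic 0) (by simp)]
      exact not_uniquelyDeterminedIn_halfLine_compl _
    · rw [h, hTab, image_trans_compl_image_ofReal F (IsometryEquiv.addRight (a : ℂ)) (· + a)
        (fun t => by simp) (S := Icc 0 (b - a)) (by simp)]
      refine not_uniquelyDeterminedIn_segment_compl _ (sub_pos.2 ?_)
      rw [hTab] at hTnt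
      obtain ⟨s, hs, t, ht, hst⟩ := hTnt.exists_lt
      exact hs.1.trans_lt (hst.trans_le ht.2)
  · rw [h]
    exact not_uniquelyDeterminedIn_halfPlane F
  · have : W = IsometryEquiv.neg ℂ '' {z | 0 < z.im} := by
      rw [h]
      ext z
      simp
    rw [this, ← image_comp]
    exact not_uniquelyDeterminedIn_halfPlane ((IsometryEquiv.neg ℂ).trans F)

end NotUniquelyDetermined

/-- Theorem 1.1 (I): if `∂U` lies on a straight line, then `U` fails to be
uniquely determined in the class of all plane domains by the relative metric of
its Hausdorff boundary iff `∂U` is connected and contains more than one point. -/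
theorem boundary_on_line_not_uniquely_determined_iff
    (U : Set (Euc 2)) (hU : IsEucDomain U)
    (hline : ∃ p v : Euc 2, v ≠ 0 ∧ ∀ x ∈ frontier U, ∃ t : ℝ, x = p + t • v) :
    ¬ UniquelyDeterminedIn {V | IsEucDomain V} U ↔
      (IsConnected (frontier U) ∧ (frontier U).Nontrivial) := by
  refine ⟨fun h => ?_, fun h => not_uniquelyDeterminedIn_of_frontier hU hline h.1 h.2⟩
  by_contra hc
  exact h (uniquelyDeterminedIn_of_frontier hU hline hc)
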